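/- arXiv:2403.08576 — 3 statements merged into one kernel-verified Lean document; each statement's English description precedes it below -/
import Mathlib

section
/- Basic energy identity for the viscous free-boundary problem (Lemma 3.1): Let (ρ,u,b⁻,b⁺) be a classical solution of the viscous free-boundary problem on [0,T]. Then for every t ∈ [0,T], ∫_{b⁻(t)}^{b⁺(t)} (½ρu² + ρe(ρ) + ½ρ(W∗ρ))(t,x) dx + ∫_0^t ∫_{b⁻(s)}^{b⁺(s)} (ε ρ^α (u_x)² − λ ρ u²)(s,x) dx ds + ½ ∫_0^t ∫_{b⁻(s)}^{b⁺(s)} ∫_{b⁻(s)}^{b⁺(s)} ϖ(x−y) ρ(s,x) ρ(s,y) (u(s,y) − u(s,x))² dy dx ds = ∫_{b⁻(0)}^{b⁺(0)} (½ρu² + ρe(ρ) + ½ρ(W∗ρ))(0,x) dx. -/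
open Real MeasureTheory Set

/-- The closed space-time region lying between two moving endpoints over a time interval. -/
def movingDomain (a b : ℝ) (bm bp : ℝ → ℝ) : Set (ℝ × ℝ) :=
  {q : ℝ × ℝ | q.1 ∈ Set.Icc a b ∧ q.2 ∈ Set.Icc (bm q.1) (bp q.1)}

theorem exists_continuous_extension_movingDomain {a b : ℝ} {bm bp : ℝ → ℝ} {f : ℝ → ℝ → ℝ}
    (hab : a ≤ b) (hle : ∀ t ∈ Icc a b, bm t ≤ bp t)
    (hbm : ContinuousOn bm (Icc a b)) (hbp : ContinuousOn bp (Icc a b))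
    (hf : ContinuousOn (fun q : ℝ × ℝ => f q.1 q.2) (movingDomain a b bm bp)) :
    ∃ F : ℝ → ℝ → ℝ, Continuous (Function.uncurry F) ∧
      ∀ t ∈ Icc a b, ∀ x ∈ Icc (bm t) (bp t), F t x = f t x := by
  let τ : ℝ → ℝ := fun t => max a (min b t)
  have hτ : Continuous τ := by fun_prop
  have hτ_mem : ∀ t, τ t ∈ Icc a b := fun t => ⟨le_max_left _ _, max_le hab (min_le_left _ _)⟩
  have hτ_eq : ∀ t ∈ Icc a b, τ t = t := fun t ht => by
    simp only [τ, min_eq_right ht.2, max_eq_right ht.1]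
  have hm : Continuous fun t => bm (τ t) := hbm.comp_continuous hτ hτ_mem
  have hp : Continuous fun t => bp (τ t) := hbp.comp_continuous hτ hτ_mem
  refine ⟨fun t x => f (τ t) (max (bm (τ t)) (min (bp (τ t)) x)), ?_, ?_⟩
  · have hc : Continuous fun q : ℝ × ℝ =>
        (τ q.1, max (bm (τ q.1)) (min (bp (τ q.1)) q.2)) := by
      have h1 := hm.comp (continuous_fst (X := ℝ) (Y := ℝ))
      have h2 := hp.comp (continuous_fst (X := ℝ) (Y := ℝ))
      exact (hτ.comp continuous_fst).prodMk (h1.max (h2.min continuous_snd))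
    exact hf.comp_continuous hc fun q =>
      ⟨hτ_mem _, le_max_left _ _, max_le (hle _ (hτ_mem _)) (min_le_left _ _)⟩
  · intro t ht x hx
    simp only [hτ_eq t ht, min_eq_right hx.2, max_eq_right hx.1]

theorem continuousOn_primitive_movingDomain {a b : ℝ} {bm bp : ℝ → ℝ} {f : ℝ → ℝ → ℝ}
    (hab : a ≤ b) (hle : ∀ t ∈ Icc a b, bm t ≤ bp t)
    (hbm : ContinuousOn bm (Icc a b)) (hbp : ContinuousOn bp (Icc a b))
    (hf : ContinuousOn (fun q : ℝ × ℝ => f q.1 q.2) (movingDomain a b bm bp)) :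
    ContinuousOn (fun q : ℝ × ℝ => ∫ y in bm q.1..q.2, f q.1 y) (movingDomain a b bm bp) := by
  obtain ⟨F, hF, hFf⟩ := exists_continuous_extension_movingDomain hab hle hbm hbp hf
  have hint : ∀ t x y, IntervalIntegrable (F t) volume x y := fun t x y =>
    (hF.comp (by fun_prop : Continuous fun x : ℝ => (t, x))).intervalIntegrable _ _
  have hprim := intervalIntegral.continuous_parametric_primitive_of_continuous
    (μ := volume) (a₀ := 0) hF
  have hfst : ContinuousOn (fun q : ℝ × ℝ => bm q.1) (movingDomain a b bm bp) :=
    hbm.comp continuousOn_fst fun q hq => hq.1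
  have hlow : ContinuousOn (fun q : ℝ × ℝ => ∫ y in (0 : ℝ)..bm q.1, F q.1 y)
      (movingDomain a b bm bp) :=
    hprim.comp_continuousOn (continuousOn_fst.prodMk hfst)
  refine (hprim.continuousOn.sub hlow).congr fun q hq => ?_
  refine Eq.trans ?_ (intervalIntegral.integral_interval_sub_left (hint _ _ _) (hint _ _ _)).symm
  refine intervalIntegral.integral_congr fun y hy => ?_
  rw [uIcc_of_le hq.2.1] at hy
  exact (hFf _ hq.1 _ ⟨hy.1, hy.2.trans hq.2.2⟩).symm

theorem continuousOn_integral_movingDomain {a b : ℝ} {bm bp : ℝ → ℝ} {f : ℝ → ℝ → ℝ}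
    (hab : a ≤ b) (hle : ∀ t ∈ Icc a b, bm t ≤ bp t)
    (hbm : ContinuousOn bm (Icc a b)) (hbp : ContinuousOn bp (Icc a b))
    (hf : ContinuousOn (fun q : ℝ × ℝ => f q.1 q.2) (movingDomain a b bm bp)) :
    ContinuousOn (fun t => ∫ y in bm t..bp t, f t y) (Icc a b) :=
  (continuousOn_primitive_movingDomain hab hle hbm hbp hf).comp
    (continuousOn_id.prodMk hbp) fun t ht => ⟨ht, hle t ht, le_rfl⟩

theorem continuousOn_slice_movingDomain {a b t : ℝ} {bm bp : ℝ → ℝ} {f : ℝ → ℝ → ℝ}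
    (ht : t ∈ Icc a b)
    (hf : ContinuousOn (fun q : ℝ × ℝ => f q.1 q.2) (movingDomain a b bm bp)) :
    ContinuousOn (f t) (Icc (bm t) (bp t)) :=
  hf.comp (f := fun x => (t, x)) (by fun_prop) fun _ hx => ⟨ht, hx⟩

theorem hasDerivAt_comp_of_partial {f ft fx : ℝ → ℝ → ℝ} {X : ℝ → ℝ} {t v : ℝ}
    {U : Set (ℝ × ℝ)} (hU : U ∈ nhds (t, X t))
    (hft : ∀ q ∈ U, HasDerivAt (fun s => f s q.2) (ft q.1 q.2) q.1)
    (hfx : ∀ q ∈ U, HasDerivAt (fun y => f q.1 y) (fx q.1 q.2) q.2)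
    (cft : ContinuousAt (fun q : ℝ × ℝ => ft q.1 q.2) (t, X t))
    (cfx : ContinuousAt (fun q : ℝ × ℝ => fx q.1 q.2) (t, X t))
    (hX : HasDerivAt X v t) :
    HasDerivAt (fun s => f s (X s)) (ft t (X t) + fx t (X t) * v) t := by
  have hcont : ∀ {g : ℝ → ℝ → ℝ}, ContinuousAt (fun q : ℝ × ℝ => g q.1 q.2) (t, X t) →
      ContinuousAt (fun q : ℝ × ℝ => ContinuousLinearMap.toSpanSingleton ℝ (g q.1 q.2))
        (t, X t) := fun hg =>
    (ContinuousLinearMap.toSpanSingletonCLE (𝕜 := ℝ) (E := ℝ)).continuous.continuousAt.comp hg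
  have hF := (hasStrictFDerivAt_uncurry_coprod (𝕜 := ℝ) (u := (t, X t)) (f := f)
    (f₁ := fun s y => ContinuousLinearMap.toSpanSingleton ℝ (ft s y))
    (f₂ := fun s y => ContinuousLinearMap.toSpanSingleton ℝ (fx s y))
    (Filter.mem_of_superset hU fun q hq => (hft q hq).hasFDerivAt)
    (Filter.mem_of_superset hU fun q hq => (hfx q hq).hasFDerivAt)
    (hcont cft) (hcont cfx)).hasFDerivAt
  have h := HasFDerivAt.comp_hasDerivAt (f := fun s => (s, X s)) t hF
    ((hasDerivAt_id t).prodMk hX)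
  refine HasDerivAt.congr_deriv h ?_
  simp [Function.HasUncurry.uncurry, mul_comm]

theorem integral_moving_interval_sub {a b : ℝ} {bm bp vm vp : ℝ → ℝ} {f ft fx : ℝ → ℝ → ℝ}
    (hab : a ≤ b) (hlt : ∀ t ∈ Icc a b, bm t < bp t)
    (hbm : ContinuousOn bm (Icc a b)) (hbp : ContinuousOn bp (Icc a b))
    (hvm : ContinuousOn vm (Icc a b)) (hvp : ContinuousOn vp (Icc a b))
    (dbm : ∀ t ∈ Ioo a b, HasDerivAt bm (vm t) t)
    (dbp : ∀ t ∈ Ioo a b, HasDerivAt bp (vp t) t)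
    (hf : ContinuousOn (fun q : ℝ × ℝ => f q.1 q.2) (movingDomain a b bm bp))
    (hft : ContinuousOn (fun q : ℝ × ℝ => ft q.1 q.2) (movingDomain a b bm bp))
    (hfx : ContinuousOn (fun q : ℝ × ℝ => fx q.1 q.2) (movingDomain a b bm bp))
    (dft : ∀ t ∈ Ioo a b, ∀ x ∈ Ioo (bm t) (bp t), HasDerivAt (fun s => f s x) (ft t x) t)
    (dfx : ∀ t ∈ Ioo a b, ∀ x ∈ Ioo (bm t) (bp t), HasDerivAt (fun y => f t y) (fx t x) x) :
    (∫ x in bm b..bp b, f b x) - ∫ x in bm a..bp a, f a x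
      = ∫ s in a..b, ((∫ x in bm s..bp s, ft s x)
          + (f s (bp s) * vp s - f s (bm s) * vm s)) := by
  let X : ℝ → ℝ → ℝ := fun s r => bm s + (bp s - bm s) * r
  let G : ℝ → ℝ → ℝ := fun s r => (bp s - bm s) * f s (X s r)
  let H : ℝ → ℝ → ℝ := fun s r => (vp s - vm s) * f s (X s r)
    + (bp s - bm s) * (ft s (X s r) + fx s (X s r) * (vm s + (vp s - vm s) * r))
  let K : Set (ℝ × ℝ) := Icc a b ×ˢ Icc 0 1
  have fstc : ∀ {g : ℝ → ℝ}, ContinuousOn g (Icc a b) →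
      ContinuousOn (fun q : ℝ × ℝ => g q.1) K := fun hg =>
    hg.comp continuousOn_fst fun q hq => hq.1
  have hXc : ContinuousOn (fun q : ℝ × ℝ => X q.1 q.2) K :=
    (fstc hbm).add (((fstc hbp).sub (fstc hbm)).mul continuousOn_snd)
  have hXmaps : MapsTo (fun q : ℝ × ℝ => (q.1, X q.1 q.2)) K (movingDomain a b bm bp) := by
    rintro ⟨s, r⟩ ⟨hs, hr⟩
    have := hlt s hs
    refine ⟨hs, ?_, ?_⟩ <;> simp only [X] <;> nlinarith [hr.1, hr.2]
  have hXc' : ContinuousOn (fun q : ℝ × ℝ => (q.1, X q.1 q.2)) K := continuousOn_fst.prodMk hXc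
  have compc : ∀ {g : ℝ → ℝ → ℝ},
      ContinuousOn (fun q : ℝ × ℝ => g q.1 q.2) (movingDomain a b bm bp) →
      ContinuousOn (fun q : ℝ × ℝ => g q.1 (X q.1 q.2)) K := fun hg => hg.comp hXc' hXmaps
  have hGc : ContinuousOn (fun q : ℝ × ℝ => G q.1 q.2) K :=
    ((fstc hbp).sub (fstc hbm)).mul (compc hf)
  have hHc : ContinuousOn (fun q : ℝ × ℝ => H q.1 q.2) K :=
    (((fstc hvp).sub (fstc hvm)).mul (compc hf)).add
      (((fstc hbp).sub (fstc hbm)).mul ((compc hft).add ((compc hfx).mul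
        ((fstc hvm).add (((fstc hvp).sub (fstc hvm)).mul continuousOn_snd)))))
  have hsubst : ∀ (g : ℝ → ℝ → ℝ) (t : ℝ), ∫ x in bm t..bp t, g t x
      = ∫ r in (0 : ℝ)..1, (bp t - bm t) * g t (X t r) := by
    intro g t
    rw [intervalIntegral.integral_const_mul]
    have := intervalIntegral.mul_integral_comp_add_mul (a := 0) (b := 1) (f := g t)
      (bp t - bm t) (bm t)
    simp only [mul_zero, mul_one, add_zero, add_sub_cancel] at this
    exact this.symm
  have hsliceT : ∀ {g : ℝ → ℝ → ℝ}, ContinuousOn (fun q : ℝ × ℝ => g q.1 q.2) K →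
      ∀ r ∈ Icc (0 : ℝ) 1, ContinuousOn (fun s => g s r) (Icc a b) := fun hg r hr =>
    hg.comp (f := fun s => (s, r)) (by fun_prop) fun s hs => ⟨hs, hr⟩
  have hsliceR : ∀ {g : ℝ → ℝ → ℝ}, ContinuousOn (fun q : ℝ × ℝ => g q.1 q.2) K →
      ∀ s ∈ Icc a b, ContinuousOn (fun r => g s r) (Icc (0 : ℝ) 1) := fun hg s hs =>
    hg.comp (f := fun r => (s, r)) (by fun_prop) fun r hr => ⟨hs, hr⟩
  have hIntR : ∀ {g : ℝ → ℝ → ℝ}, ContinuousOn (fun q : ℝ × ℝ => g q.1 q.2) K →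
      ∀ s ∈ Icc a b, IntervalIntegrable (g s) volume 0 1 := fun hg s hs =>
    (hsliceR hg s hs).intervalIntegrable_of_Icc zero_le_one
  have htime : ∀ r ∈ Ioo (0 : ℝ) 1, G b r - G a r = ∫ s in a..b, H s r := by
    intro r hr
    have hr' := Ioo_subset_Icc_self hr
    refine (intervalIntegral.integral_eq_sub_of_hasDerivAt_of_le hab
      (hsliceT hGc r hr') (fun s hs => ?_)
      ((hsliceT hHc r hr').intervalIntegrable_of_Icc hab)).symm
    have hXmem : X s r ∈ Ioo (bm s) (bp s) := by
      have := hlt s (Ioo_subset_Icc_self hs)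
      constructor <;> simp only [X] <;> nlinarith [hr.1, hr.2]
    have hUo : {q : ℝ × ℝ | q.1 ∈ Ioo a b ∧ q.2 ∈ Ioo (bm q.1) (bp q.1)} ∈ nhds (s, X s r) := by
      have hfst : Filter.Tendsto (Prod.fst : ℝ × ℝ → ℝ) (nhds (s, X s r)) (nhds s) :=
        continuous_fst.tendsto _
      have hsnd : Filter.Tendsto (Prod.snd : ℝ × ℝ → ℝ) (nhds (s, X s r)) (nhds (X s r)) :=
        continuous_snd.tendsto _
      filter_upwards [hfst.eventually (Ioo_mem_nhds hs.1 hs.2),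
        ((dbm s hs).continuousAt.tendsto.comp hfst).eventually_lt hsnd hXmem.1,
        hsnd.eventually_lt ((dbp s hs).continuousAt.tendsto.comp hfst) hXmem.2] with q h1 h2 h3
      exact ⟨h1, h2, h3⟩
    have hUd : movingDomain a b bm bp ∈ nhds (s, X s r) :=
      Filter.mem_of_superset hUo fun q hq =>
        ⟨Ioo_subset_Icc_self hq.1, Ioo_subset_Icc_self hq.2⟩
    have dX : HasDerivAt (fun τ => X τ r) (vm s + (vp s - vm s) * r) s :=
      (dbm s hs).add (((dbp s hs).sub (dbm s hs)).mul_const r)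
    have dF := hasDerivAt_comp_of_partial (X := fun τ => X τ r) hUo
      (fun q hq => dft _ hq.1 _ hq.2) (fun q hq => dfx _ hq.1 _ hq.2)
      (hft.continuousAt hUd) (hfx.continuousAt hUd) dX
    exact ((dbp s hs).sub (dbm s hs)).mul dF
  have hspace : ∀ s ∈ Ioo a b, ∫ r in (0 : ℝ)..1, H s r
      = (∫ x in bm s..bp s, ft s x) + (f s (bp s) * vp s - f s (bm s) * vm s) := by
    intro s hs
    have hs' := Ioo_subset_Icc_self hs
    have hlts := hlt s hs'
    let V : ℝ → ℝ := fun r => vm s + (vp s - vm s) * r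
    have hVc : ContinuousOn V (Icc 0 1) := by fun_prop
    have h1 : IntervalIntegrable (fun r => (bp s - bm s) * ft s (X s r)) volume 0 1 :=
      ((hsliceR (g := fun s r => ft s (X s r)) (compc hft) s hs').intervalIntegrable_of_Icc
        zero_le_one).const_mul _
    have hc2 : ContinuousOn (fun r => fx s (X s r) * (bp s - bm s) * V r
        + f s (X s r) * (vp s - vm s)) (Icc 0 1) :=
      (((hsliceR (g := fun s r => fx s (X s r)) (compc hfx) s hs').mul_const _).mul hVc).add
        ((hsliceR (g := fun s r => f s (X s r)) (compc hf) s hs').mul_const _)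
    have hftc := intervalIntegral.integral_eq_sub_of_hasDerivAt_of_le
      (f := fun r => f s (X s r) * V r) zero_le_one
      ((hsliceR (g := fun s r => f s (X s r)) (compc hf) s hs').mul hVc)
      (fun r hr => ?_) (hc2.intervalIntegrable_of_Icc zero_le_one)
    · rw [hsubst ft s]
      have hX1 : X s 1 = bp s := by simp [X]
      have hX0 : X s 0 = bm s := by simp [X]
      have hV1 : V 1 = vp s := by simp [V]
      have hV0 : V 0 = vm s := by simp [V]
      simp only [hX1, hX0, hV1, hV0] at hftc
      rw [← hftc, ← intervalIntegral.integral_add h1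
        (hc2.intervalIntegrable_of_Icc zero_le_one)]
      refine intervalIntegral.integral_congr fun r _ => ?_
      simp only [H, V]
      ring
    · have hXmem : X s r ∈ Ioo (bm s) (bp s) := by
        constructor <;> simp only [X] <;> nlinarith [hr.1, hr.2]
      have dX : HasDerivAt (fun r => X s r) (bp s - bm s) r := by
        exact (((hasDerivAt_id r).const_mul (bp s - bm s)).const_add (bm s)).congr_deriv
          (mul_one _)
      have dV : HasDerivAt V (vp s - vm s) r := by
        exact (((hasDerivAt_id r).const_mul (vp s - vm s)).const_add (vm s)).congr_deriv
          (mul_one _)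
      exact ((dfx s hs _ hXmem).comp r dX).mul dV
  rw [hsubst f b, hsubst f a, ← intervalIntegral.integral_sub
    (hIntR hGc b (right_mem_Icc.2 hab)) (hIntR hGc a (left_mem_Icc.2 hab)),
    intervalIntegral.integral_congr_Ioo_of_le zero_le_one htime,
    ← intervalIntegral_intervalIntegral_swap,
    intervalIntegral.integral_congr_Ioo_of_le hab hspace]
  rw [uIoc_of_le hab, uIoc_of_le zero_le_one]
  exact (hHc.integrableOn_compact (isCompact_Icc.prod isCompact_Icc)).mono_set
    (prod_mono Ioc_subset_Icc_self Ioc_subset_Icc_self)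

theorem hasDerivAt_primitive_of_continuousOn {g : ℝ → ℝ} {a b x : ℝ}
    (hg : ContinuousOn g (Icc a b)) (hx : x ∈ Ioo a b) :
    HasDerivAt (fun z => ∫ y in a..z, g y) (g x) x :=
  intervalIntegral.integral_hasDerivAt_right
    ((hg.mono (Icc_subset_Icc_right hx.2.le)).intervalIntegrable_of_Icc hx.1.le)
    ((hg.mono Ioo_subset_Icc_self).stronglyMeasurableAtFilter isOpen_Ioo x hx)
    (hg.continuousAt (Icc_mem_nhds hx.1 hx.2))

theorem continuousOn_primitive_of_continuousOn {g : ℝ → ℝ} {a b : ℝ} (hab : a ≤ b)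
    (hg : ContinuousOn g (Icc a b)) : ContinuousOn (fun z => ∫ y in a..z, g y) (Icc a b) := by
  have := intervalIntegral.continuousOn_primitive_interval (μ := volume) (f := g) (a := a) (b := b)
    (by rw [uIcc_of_le hab]; exact hg.integrableOn_Icc)
  rwa [uIcc_of_le hab] at this

theorem integral_quadratic_mul {g : ℝ → ℝ} {a b : ℝ} (hab : a ≤ b)
    (hg : ContinuousOn g (Icc a b)) (c₀ c₁ c₂ : ℝ) :
    ∫ y in a..b, (c₀ + c₁ * y + c₂ * y ^ 2) * g y
      = c₀ * (∫ y in a..b, g y) + c₁ * (∫ y in a..b, y * g y)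
        + c₂ * ∫ y in a..b, y ^ 2 * g y := by
  have h0 : IntervalIntegrable g volume a b := hg.intervalIntegrable_of_Icc hab
  have h1 : IntervalIntegrable (fun y => y * g y) volume a b :=
    ContinuousOn.intervalIntegrable_of_Icc hab (by fun_prop)
  have h2 : IntervalIntegrable (fun y => y ^ 2 * g y) volume a b :=
    ContinuousOn.intervalIntegrable_of_Icc hab (by fun_prop)
  simp only [← intervalIntegral.integral_const_mul]
  rw [← intervalIntegral.integral_add (h0.const_mul _) (h1.const_mul _),
    ← intervalIntegral.integral_add ((h0.const_mul _).add (h1.const_mul _)) (h2.const_mul _)]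
  exact intervalIntegral.integral_congr fun y _ => by ring

theorem interaction_potential_eq {g : ℝ → ℝ} {a b x : ℝ} (hg : ContinuousOn g (Icc a b))
    (hx : x ∈ Icc a b) :
    ∫ y in a..b, (-|x - y| + (x - y) ^ 2 / 2) * g y
      = -(2 * x * (∫ y in a..x, g y) - 2 * (∫ y in a..x, y * g y)
            - x * (∫ y in a..b, g y) + ∫ y in a..b, y * g y)
        + (x ^ 2 * (∫ y in a..b, g y) - 2 * x * (∫ y in a..b, y * g y)
            + ∫ y in a..b, y ^ 2 * g y) / 2 := by
  have hab := hx.1.trans hx.2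
  have hl := hg.mono (Icc_subset_Icc_right hx.2)
  have hr := hg.mono (Icc_subset_Icc_left hx.1)
  have split : ∀ {f : ℝ → ℝ}, ContinuousOn f (Icc a b) →
      ∫ y in a..b, f y = (∫ y in a..x, f y) + ∫ y in x..b, f y := fun hf =>
    (intervalIntegral.integral_add_adjacent_intervals
      ((hf.mono (Icc_subset_Icc_right hx.2)).intervalIntegrable_of_Icc hx.1)
      ((hf.mono (Icc_subset_Icc_left hx.1)).intervalIntegrable_of_Icc hx.2)).symm
  have e1 : ∫ y in a..x, (-|x - y| + (x - y) ^ 2 / 2) * g y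
      = ∫ y in a..x, ((-x + x ^ 2 / 2) + (1 - x) * y + 1 / 2 * y ^ 2) * g y := by
    refine intervalIntegral.integral_congr fun y hy => ?_
    rw [uIcc_of_le hx.1] at hy
    simp only [abs_of_nonneg (sub_nonneg.2 hy.2)]
    ring
  have e2 : ∫ y in x..b, (-|x - y| + (x - y) ^ 2 / 2) * g y
      = ∫ y in x..b, ((x + x ^ 2 / 2) + (-1 - x) * y + 1 / 2 * y ^ 2) * g y := by
    refine intervalIntegral.integral_congr fun y hy => ?_
    rw [uIcc_of_le hx.2] at hy
    simp only [abs_of_nonpos (sub_nonpos.2 hy.1)]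
    ring
  rw [split (f := fun y => (-|x - y| + (x - y) ^ 2 / 2) * g y) (by fun_prop), e1, e2,
    integral_quadratic_mul hx.1 hl, integral_quadratic_mul hx.2 hr, split hg,
    split (f := fun y => y * g y) (by fun_prop), split (f := fun y => y ^ 2 * g y) (by fun_prop)]
  ring

theorem continuousOn_interaction_potential {g : ℝ → ℝ} {a b : ℝ} (hab : a ≤ b)
    (hg : ContinuousOn g (Icc a b)) :
    ContinuousOn (fun x => ∫ y in a..b, (-|x - y| + (x - y) ^ 2 / 2) * g y) (Icc a b) := by
  have cM := continuousOn_primitive_of_continuousOn hab hg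
  have cN := continuousOn_primitive_of_continuousOn hab (g := fun y => y * g y) (by fun_prop)
  refine ContinuousOn.congr ?_ fun x hx => interaction_potential_eq hg hx
  fun_prop

theorem hasDerivAt_interaction_potential {g : ℝ → ℝ} {a b x : ℝ}
    (hg : ContinuousOn g (Icc a b)) (hx : x ∈ Ioo a b) :
    HasDerivAt (fun z => ∫ y in a..b, (-|z - y| + (z - y) ^ 2 / 2) * g y)
      (-(2 * (∫ y in a..x, g y) - ∫ y in a..b, g y)
        + x * (∫ y in a..b, g y) - ∫ y in a..b, y * g y) x := by
  have hM := hasDerivAt_primitive_of_continuousOn hg hx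
  have hN := hasDerivAt_primitive_of_continuousOn (g := fun y => y * g y) (by fun_prop) hx
  have hid := hasDerivAt_id x
  have h := ((((hid.const_mul 2).mul hM).sub (hN.const_mul 2)).sub
    (hid.mul_const (∫ y in a..b, g y))).add_const (∫ y in a..b, y * g y) |>.neg.add
    (((((hid.pow 2).mul_const (∫ y in a..b, g y)).sub
      ((hid.const_mul 2).mul_const (∫ y in a..b, y * g y))).add_const
        (∫ y in a..b, y ^ 2 * g y)).div_const 2)
  refine (h.congr_of_eventuallyEq ?_).congr_deriv ?_
  · filter_upwards [Icc_mem_nhds hx.1 hx.2] with z hz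
    exact interaction_potential_eq hg hz
  · simp only [id]
    ring

theorem integral_interaction_energy {g : ℝ → ℝ} {a b : ℝ} (hab : a ≤ b)
    (hg : ContinuousOn g (Icc a b)) :
    ∫ x in a..b, 1 / 2 * g x * ∫ y in a..b, (-|x - y| + (x - y) ^ 2 / 2) * g y
      = 1 / 2 * ((∫ y in a..b, g y) * (∫ y in a..b, y ^ 2 * g y) - (∫ y in a..b, y * g y) ^ 2)
        - ∫ x in a..b, (∫ y in a..x, g y) * ((∫ y in a..b, g y) - ∫ y in a..x, g y) := by
  have hg1 : ContinuousOn (fun y => y * g y) (Icc a b) := by fun_prop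
  have hg2 : ContinuousOn (fun y => y ^ 2 * g y) (Icc a b) := by fun_prop
  have cM := continuousOn_primitive_of_continuousOn hab hg
  have cN := continuousOn_primitive_of_continuousOn hab hg1
  have cS := continuousOn_primitive_of_continuousOn hab hg2
  have hM := fun x hx => hasDerivAt_primitive_of_continuousOn (x := x) hg hx
  have hN := fun x hx => hasDerivAt_primitive_of_continuousOn (x := x) hg1 hx
  have hS := fun x hx => hasDerivAt_primitive_of_continuousOn (x := x) hg2 hx
  have hpot : ∫ x in a..b, 1 / 2 * g x * ∫ y in a..b, (-|x - y| + (x - y) ^ 2 / 2) * g y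
      = ∫ x in a..b, 1 / 2 * g x *
        (-(2 * x * (∫ y in a..x, g y) - 2 * (∫ y in a..x, y * g y)
            - x * (∫ y in a..b, g y) + ∫ y in a..b, y * g y)
        + (x ^ 2 * (∫ y in a..b, g y) - 2 * x * (∫ y in a..b, y * g y)
            + ∫ y in a..b, y ^ 2 * g y) / 2) := by
    refine intervalIntegral.integral_congr fun x hx => ?_
    rw [uIcc_of_le hab] at hx
    simp only [interaction_potential_eq hg hx]
  rw [hpot, eq_sub_iff_add_eq]
  have hMa : ∫ y in a..a, g y = 0 := intervalIntegral.integral_same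
  have hNa : ∫ y in a..a, y * g y = 0 := intervalIntegral.integral_same
  have hSa : ∫ y in a..a, y ^ 2 * g y = 0 := intervalIntegral.integral_same
  obtain ⟨M, eM⟩ : ∃ M : ℝ → ℝ, ∀ x, ∫ y in a..x, g y = M x := ⟨_, fun _ => rfl⟩
  obtain ⟨N, eN⟩ : ∃ N : ℝ → ℝ, ∀ x, ∫ y in a..x, y * g y = N x := ⟨_, fun _ => rfl⟩
  obtain ⟨S, eS⟩ : ∃ S : ℝ → ℝ, ∀ x, ∫ y in a..x, y ^ 2 * g y = S x := ⟨_, fun _ => rfl⟩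
  simp only [eM, eN, eS] at cM cN cS hM hN hS hMa hNa hSa ⊢
  rw [← intervalIntegral.integral_add (ContinuousOn.intervalIntegrable_of_Icc hab (by fun_prop))
    (ContinuousOn.intervalIntegrable_of_Icc hab (by fun_prop)),
    intervalIntegral.integral_eq_sub_of_hasDerivAt_of_le (f := fun x =>
      -(1 / 2) * ((M x - M b / 2) * (2 * x * M x - 2 * N x - x * M b + N b))
        + M b ^ 2 / 4 * x + 1 / 4 * (M b * S x - 2 * N b * N x + S b * M x)) hab
      (by fun_prop) (fun x hx => ?_)
      (ContinuousOn.intervalIntegrable_of_Icc hab (by fun_prop))]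
  · rw [hMa, hNa, hSa]
    ring
  · have hid := hasDerivAt_id x
    refine HasDerivAt.congr_deriv ((((((hM x hx).sub_const (M b / 2)).mul
      (((((hid.const_mul 2).mul (hM x hx)).sub ((hN x hx).const_mul 2)).sub
        (hid.mul_const (M b))).add_const (N b))).const_mul (-(1 / 2))).add
      (hid.const_mul (M b ^ 2 / 4))).add
      (((((hS x hx).const_mul (M b)).sub ((hN x hx).const_mul (2 * N b))).add
        ((hM x hx).const_mul (S b))).const_mul (1 / 4))) ?_
    simp only [id, Pi.sub_apply, Pi.mul_apply]
    ring

theorem integral_alignment_symmetrization {cw g v : ℝ → ℝ} {a b : ℝ} (hab : a ≤ b)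
    (hcw_meas : Measurable cw) (hcw_bdd : ∃ C : ℝ, ∀ x, |cw x| ≤ C)
    (hcw_even : ∀ x, cw (-x) = cw x)
    (hg : ContinuousOn g (Icc a b)) (hv : ContinuousOn v (Icc a b)) :
    IntervalIntegrable
      (fun x => g x * v x * ∫ y in a..b, cw (x - y) * (v y - v x) * g y) volume a b ∧
    ∫ x in a..b, g x * v x * ∫ y in a..b, cw (x - y) * (v y - v x) * g y
      = -(1 / 2) * ∫ x in a..b, ∫ y in a..b, cw (x - y) * g x * g y * (v y - v x) ^ 2 := by
  obtain ⟨C, hC⟩ := hcw_bdd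
  let μ := volume.restrict (Ioc a b)
  let h : ℝ × ℝ → ℝ := fun z => cw (z.1 - z.2) * (g z.1 * g z.2 * v z.1 * (v z.2 - v z.1))
  let q : ℝ × ℝ → ℝ := fun z => cw (z.1 - z.2) * g z.1 * g z.2 * (v z.2 - v z.1) ^ 2
  have hh : Integrable h (μ.prod μ) := by
    have hfst : ∀ {f : ℝ → ℝ}, ContinuousOn f (Icc a b) →
        ContinuousOn (fun z : ℝ × ℝ => f z.1) (Icc a b ×ˢ Icc a b) := fun hf =>
      hf.comp continuousOn_fst fun z hz => hz.1
    have hsnd : ∀ {f : ℝ → ℝ}, ContinuousOn f (Icc a b) →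
        ContinuousOn (fun z : ℝ × ℝ => f z.2) (Icc a b ×ˢ Icc a b) := fun hf =>
      hf.comp continuousOn_snd fun z hz => hz.2
    have hk : ContinuousOn (fun z : ℝ × ℝ => g z.1 * g z.2 * v z.1 * (v z.2 - v z.1))
        (Icc a b ×ˢ Icc a b) :=
      (((hfst hg).mul (hsnd hg)).mul (hfst hv)).mul ((hsnd hv).sub (hfst hv))
    have hki : Integrable (fun z : ℝ × ℝ => g z.1 * g z.2 * v z.1 * (v z.2 - v z.1))
        (μ.prod μ) := by
      rw [Measure.prod_restrict]
      exact (hk.integrableOn_compact (isCompact_Icc.prod isCompact_Icc)).mono_set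
        (prod_mono Ioc_subset_Icc_self Ioc_subset_Icc_self)
    exact hki.bdd_mul (hcw_meas.comp (measurable_fst.sub measurable_snd)).aestronglyMeasurable
      (Filter.Eventually.of_forall fun z => hC _)
  have hq : ∀ z, q z = -(h z + h z.swap) := by
    intro z
    have : cw (z.2 - z.1) = cw (z.1 - z.2) := by rw [← hcw_even, neg_sub]
    simp only [q, h, Prod.fst_swap, Prod.snd_swap, this]
    ring
  have hqi : Integrable q (μ.prod μ) := (hh.add hh.swap).neg.congr
    (Filter.Eventually.of_forall fun z => (hq z).symm)
  have hinner : ∀ x, g x * v x * ∫ y in a..b, cw (x - y) * (v y - v x) * g y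
      = ∫ y, h (x, y) ∂μ := by
    intro x
    rw [← intervalIntegral.integral_const_mul, intervalIntegral.integral_of_le hab]
    exact integral_congr_ae (Filter.Eventually.of_forall fun y => by simp only [h]; ring)
  simp only [hinner]
  refine ⟨(intervalIntegrable_iff_integrableOn_Ioc_of_le hab).2 hh.integral_prod_left, ?_⟩
  simp only [intervalIntegral.integral_of_le hab]
  have e1 : ∫ x, ∫ y, h (x, y) ∂μ ∂μ = ∫ z, h z ∂μ.prod μ := (integral_prod _ hh).symm
  have e2 : ∫ x, ∫ y, q (x, y) ∂μ ∂μ = ∫ z, q z ∂μ.prod μ := (integral_prod _ hqi).symm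
  refine e1.trans (Eq.trans ?_ (congrArg (fun w => -(1 / 2) * w) e2).symm)
  have e3 : ∫ z, q z ∂μ.prod μ = -(2 * ∫ z, h z ∂μ.prod μ) := by
    simp only [hq]
    have hs : ∫ z, h z.swap ∂μ.prod μ = ∫ z, h z ∂μ.prod μ := integral_prod_swap h
    have hsi : Integrable (fun z => h z.swap) (μ.prod μ) := hh.swap
    rw [integral_neg, integral_add hh hsi, hs]
    ring
  simp only [e3]
  ring

/-- A positive-length moving interval carrying a density that solves the continuity equation. -/
structure TransportedDensity (a b : ℝ) (bm bp vm vp : ℝ → ℝ) (ρ u ρt ρx ux : ℝ → ℝ → ℝ) :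
    Prop where
  le : a ≤ b
  lt : ∀ t ∈ Icc a b, bm t < bp t
  contLeft : ContinuousOn bm (Icc a b)
  contRight : ContinuousOn bp (Icc a b)
  contVelLeft : ContinuousOn vm (Icc a b)
  contVelRight : ContinuousOn vp (Icc a b)
  derivLeft : ∀ t ∈ Ioo a b, HasDerivAt bm (vm t) t
  derivRight : ∀ t ∈ Ioo a b, HasDerivAt bp (vp t) t
  contDensity : ContinuousOn (fun q : ℝ × ℝ => ρ q.1 q.2) (movingDomain a b bm bp)
  contVelocity : ContinuousOn (fun q : ℝ × ℝ => u q.1 q.2) (movingDomain a b bm bp)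
  contDensityTime : ContinuousOn (fun q : ℝ × ℝ => ρt q.1 q.2) (movingDomain a b bm bp)
  contDensitySpace : ContinuousOn (fun q : ℝ × ℝ => ρx q.1 q.2) (movingDomain a b bm bp)
  contVelocitySpace : ContinuousOn (fun q : ℝ × ℝ => ux q.1 q.2) (movingDomain a b bm bp)
  derivDensityTime : ∀ t ∈ Icc a b, ∀ x ∈ Icc (bm t) (bp t), HasDerivAt (fun s => ρ s x) (ρt t x) t
  derivDensitySpace : ∀ t ∈ Icc a b, ∀ x ∈ Icc (bm t) (bp t), HasDerivAt (ρ t) (ρx t x) x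
  derivVelocitySpace : ∀ t ∈ Icc a b, ∀ x ∈ Icc (bm t) (bp t), HasDerivAt (u t) (ux t x) x
  continuity : ∀ t ∈ Icc a b, ∀ x ∈ Icc (bm t) (bp t),
    ρt t x + (ρx t x * u t x + ρ t x * ux t x) = 0

namespace TransportedDensity

variable {a b : ℝ} {bm bp vm vp : ℝ → ℝ} {ρ u ρt ρx ux : ℝ → ℝ → ℝ}

theorem le_endpoints (h : TransportedDensity a b bm bp vm vp ρ u ρt ρx ux) :
    ∀ t ∈ Icc a b, bm t ≤ bp t := fun t ht => (h.lt t ht).le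

theorem restrict (h : TransportedDensity a b bm bp vm vp ρ u ρt ρx ux) {c d : ℝ} {bp' vp' : ℝ → ℝ}
    (hac : a ≤ c) (hcd : c ≤ d) (hdb : d ≤ b)
    (hlt : ∀ t ∈ Icc c d, bm t < bp' t) (hle : ∀ t ∈ Icc c d, bp' t ≤ bp t)
    (hbp : ContinuousOn bp' (Icc c d)) (hvp : ContinuousOn vp' (Icc c d))
    (dbp : ∀ t ∈ Ioo c d, HasDerivAt bp' (vp' t) t) :
    TransportedDensity c d bm bp' vm vp' ρ u ρt ρx ux := by
  have ht : Icc c d ⊆ Icc a b := Icc_subset_Icc hac hdb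
  have hto : Ioo c d ⊆ Ioo a b := Ioo_subset_Ioo hac hdb
  have hx : ∀ t ∈ Icc c d, Icc (bm t) (bp' t) ⊆ Icc (bm t) (bp t) := fun t h =>
    Icc_subset_Icc_right (hle t h)
  have hd : movingDomain c d bm bp' ⊆ movingDomain a b bm bp := fun q hq =>
    ⟨ht hq.1, hx _ hq.1 hq.2⟩
  exact
    { le := hcd
      lt := hlt
      contLeft := h.contLeft.mono ht
      contRight := hbp
      contVelLeft := h.contVelLeft.mono ht
      contVelRight := hvp
      derivLeft := fun t h' => h.derivLeft t (hto h')
      derivRight := dbp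
      contDensity := h.contDensity.mono hd
      contVelocity := h.contVelocity.mono hd
      contDensityTime := h.contDensityTime.mono hd
      contDensitySpace := h.contDensitySpace.mono hd
      contVelocitySpace := h.contVelocitySpace.mono hd
      derivDensityTime := fun t h' x hx' => h.derivDensityTime t (ht h') x (hx t h' hx')
      derivDensitySpace := fun t h' x hx' => h.derivDensitySpace t (ht h') x (hx t h' hx')
      derivVelocitySpace := fun t h' x hx' => h.derivVelocitySpace t (ht h') x (hx t h' hx')
      continuity := fun t h' x hx' => h.continuity t (ht h') x (hx t h' hx') }

theorem integral_moment_sub (h : TransportedDensity a b bm bp vm vp ρ u ρt ρx ux)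
    {φ φ' : ℝ → ℝ} (hφ : ∀ x, HasDerivAt φ (φ' x) x) (hφ' : Continuous φ') :
    (∫ x in bm b..bp b, φ x * ρ b x) - ∫ x in bm a..bp a, φ x * ρ a x
      = ∫ s in a..b, ((∫ x in bm s..bp s, φ' x * (ρ s x * u s x))
          + (φ (bp s) * ρ s (bp s) * (vp s - u s (bp s))
            - φ (bm s) * ρ s (bm s) * (vm s - u s (bm s)))) := by
  have hφc : Continuous φ := continuous_iff_continuousAt.2 fun x => (hφ x).continuousAt
  have c1 := h.contDensity
  have c2 := h.contDensityTime
  have c3 := h.contDensitySpace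
  rw [integral_moving_interval_sub (f := fun t x => φ x * ρ t x) (ft := fun t x => φ x * ρt t x)
    (fx := fun t x => φ' x * ρ t x + φ x * ρx t x) h.le h.lt h.contLeft h.contRight
    h.contVelLeft h.contVelRight h.derivLeft h.derivRight (by fun_prop) (by fun_prop) (by fun_prop)
    (fun t ht x hx => (h.derivDensityTime t (Ioo_subset_Icc_self ht) x
      (Ioo_subset_Icc_self hx)).const_mul _)
    (fun t ht x hx => (hφ x).mul (h.derivDensitySpace t (Ioo_subset_Icc_self ht) x
      (Ioo_subset_Icc_self hx)))]
  refine intervalIntegral.integral_congr fun s hs => ?_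
  rw [uIcc_of_le h.le] at hs
  have hle := h.le_endpoints s hs
  have s1 := continuousOn_slice_movingDomain hs c1
  have s2 := continuousOn_slice_movingDomain hs c2
  have s3 := continuousOn_slice_movingDomain hs c3
  have s4 := continuousOn_slice_movingDomain hs h.contVelocity
  have s5 := continuousOn_slice_movingDomain hs h.contVelocitySpace
  have hsum : (∫ x in bm s..bp s, φ x * ρt s x) - ∫ x in bm s..bp s, φ' x * (ρ s x * u s x)
      = -(φ (bp s) * (ρ s (bp s) * u s (bp s)) - φ (bm s) * (ρ s (bm s) * u s (bm s))) := by
    rw [← intervalIntegral.integral_sub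
      (ContinuousOn.intervalIntegrable_of_Icc hle (by fun_prop))
      (ContinuousOn.intervalIntegrable_of_Icc hle (by fun_prop)),
      ← intervalIntegral.integral_eq_sub_of_hasDerivAt_of_le
        (f := fun x => φ x * (ρ s x * u s x)) hle (by fun_prop)
        (fun x hx => (hφ x).mul ((h.derivDensitySpace s hs x (Ioo_subset_Icc_self hx)).mul
          (h.derivVelocitySpace s hs x (Ioo_subset_Icc_self hx))))
        (ContinuousOn.intervalIntegrable_of_Icc hle (by fun_prop)),
      ← intervalIntegral.integral_neg]
    refine intervalIntegral.integral_congr fun x hx => ?_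
    rw [uIcc_of_le hle] at hx
    have := h.continuity s hs x hx
    linear_combination φ x * this
  linear_combination hsum

theorem hasDerivAt_partial_mass (h : TransportedDensity a b bm bp vm vp ρ u ρt ρx ux)
    (hvm : ∀ t ∈ Icc a b, vm t = u t (bm t)) {t x : ℝ} (ht : t ∈ Ioo a b)
    (hx : x ∈ Ioo (bm t) (bp t)) :
    HasDerivAt (fun s => ∫ y in bm s..x, ρ s y) (-(ρ t x * u t x)) t := by
  have hev : ∀ᶠ s in nhds t, s ∈ Ioo a b ∧ bm s < x ∧ x < bp s := by
    filter_upwards [Ioo_mem_nhds ht.1 ht.2,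
      (h.derivLeft t ht).continuousAt.tendsto.eventually_lt_const hx.1,
      (h.derivRight t ht).continuousAt.tendsto.eventually_const_lt hx.2] with s h1 h2 h3
    exact ⟨h1, h2, h3⟩
  obtain ⟨δ, hδ, hsub⟩ := (nhds_basis_Icc_pos t).mem_iff.1 hev
  have hwin : ∀ s ∈ Icc (t - δ) (t + δ), s ∈ Ioo a b ∧ bm s < x ∧ x < bp s := fun s hs => hsub hs
  have hl := hwin (t - δ) ⟨le_rfl, by linarith⟩
  have hflux : ContinuousOn (fun s => -(ρ s x * u s x)) (Icc (t - δ) (t + δ)) := by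
    have hc : ContinuousOn (fun s : ℝ => (s, x)) (Icc (t - δ) (t + δ)) := by fun_prop
    have hm : MapsTo (fun s : ℝ => (s, x)) (Icc (t - δ) (t + δ)) (movingDomain a b bm bp) :=
      fun s hs => ⟨Ioo_subset_Icc_self (hwin s hs).1, (hwin s hs).2.1.le, (hwin s hs).2.2.le⟩
    exact ((h.contDensity.comp hc hm).mul (h.contVelocity.comp hc hm)).neg
  have hprim := hasDerivAt_primitive_of_continuousOn (x := t) hflux ⟨by linarith, by linarith⟩
  refine (hprim.const_add (∫ y in bm (t - δ)..x, ρ (t - δ) y)).congr_of_eventuallyEq ?_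
  filter_upwards [Icc_mem_nhds (by linarith : t - δ < t) (by linarith : t < t + δ)] with s hs
  have hin : ∀ r ∈ Icc (t - δ) s, r ∈ Icc (t - δ) (t + δ) := fun r hr => ⟨hr.1, hr.2.trans hs.2⟩
  have hres := h.restrict (c := t - δ) (d := s) (bp' := fun _ => x) (vp' := fun _ => 0)
    hl.1.1.le hs.1 (hwin s hs).1.2.le (fun r hr => (hwin r (hin r hr)).2.1)
    (fun r hr => (hwin r (hin r hr)).2.2.le) continuousOn_const continuousOn_const
    (fun r _ => hasDerivAt_const _ _)
  have hmom := hres.integral_moment_sub (φ := fun _ => 1) (φ' := fun _ => 0)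
    (fun y => hasDerivAt_const y 1) continuous_const
  simp only [one_mul, zero_mul, intervalIntegral.integral_zero, zero_add, zero_sub] at hmom
  rw [← sub_eq_iff_eq_add', hmom]
  refine intervalIntegral.integral_congr fun r hr => ?_
  rw [uIcc_of_le hs.1] at hr
  simp only [hvm r (Ioo_subset_Icc_self (hwin r (hin r hr)).1)]
  ring

theorem integral_interaction_energy_sub (h : TransportedDensity a b bm bp vm vp ρ u ρt ρx ux)
    (hvm : ∀ t ∈ Icc a b, vm t = u t (bm t)) (hvp : ∀ t ∈ Icc a b, vp t = u t (bp t))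
    {Wx : ℝ → ℝ → ℝ}
    (hWx : ∀ t ∈ Icc a b, ∀ x ∈ Icc (bm t) (bp t),
      HasDerivAt (fun z => ∫ y in bm t..bp t, (-|z - y| + (z - y) ^ 2 / 2) * ρ t y) (Wx t x) x) :
    IntervalIntegrable (fun s => ∫ x in bm s..bp s, ρ s x * u s x * Wx s x) volume a b ∧
    (∀ s ∈ Icc a b, IntervalIntegrable (fun x => ρ s x * u s x * Wx s x) volume (bm s) (bp s)) ∧
    (∫ x in bm b..bp b,
        1 / 2 * ρ b x * ∫ y in bm b..bp b, (-|x - y| + (x - y) ^ 2 / 2) * ρ b y)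
      - (∫ x in bm a..bp a,
        1 / 2 * ρ a x * ∫ y in bm a..bp a, (-|x - y| + (x - y) ^ 2 / 2) * ρ a y)
      = ∫ s in a..b, ∫ x in bm s..bp s, ρ s x * u s x * Wx s x := by
  have hle := h.le_endpoints
  have cρ := h.contDensity
  have cu := h.contVelocity
  have ha := left_mem_Icc.2 h.le
  have hb := right_mem_Icc.2 h.le
  obtain ⟨M, eM⟩ : ∃ M : ℝ → ℝ → ℝ, ∀ t x, ∫ y in bm t..x, ρ t y = M t x := ⟨_, fun _ _ => rfl⟩
  obtain ⟨m₁, em₁⟩ : ∃ m : ℝ → ℝ, ∀ t, ∫ y in bm t..bp t, y * ρ t y = m t := ⟨_, fun _ => rfl⟩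
  obtain ⟨m₂, em₂⟩ : ∃ m : ℝ → ℝ, ∀ t, ∫ y in bm t..bp t, y ^ 2 * ρ t y = m t := ⟨_, fun _ => rfl⟩
  obtain ⟨Q, eQ⟩ : ∃ Q : ℝ → ℝ, ∀ t, ∫ y in bm t..bp t, ρ t y * u t y = Q t := ⟨_, fun _ => rfl⟩
  obtain ⟨R, eR⟩ : ∃ R : ℝ → ℝ, ∀ t, ∫ y in bm t..bp t, y * (ρ t y * u t y) = R t :=
    ⟨_, fun _ => rfl⟩
  have cM : ContinuousOn (fun q : ℝ × ℝ => M q.1 q.2) (movingDomain a b bm bp) := by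
    simpa only [eM] using continuousOn_primitive_movingDomain h.le hle h.contLeft h.contRight cρ
  have cI : ∀ {f : ℝ → ℝ → ℝ},
      ContinuousOn (fun q : ℝ × ℝ => f q.1 q.2) (movingDomain a b bm bp) →
      ContinuousOn (fun t => ∫ y in bm t..bp t, f t y) (Icc a b) := fun hf =>
    continuousOn_integral_movingDomain h.le hle h.contLeft h.contRight hf
  have cQ : ContinuousOn Q (Icc a b) := by
    simpa only [eQ] using cI (f := fun t y => ρ t y * u t y) (by fun_prop)
  have cR : ContinuousOn R (Icc a b) := by
    simpa only [eR] using cI (f := fun t y => y * (ρ t y * u t y)) (by fun_prop)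
  have cm₁ : ContinuousOn m₁ (Icc a b) := by
    simpa only [em₁] using cI (f := fun t y => y * ρ t y) (by fun_prop)
  have hrest : ∀ t ∈ Icc a b, TransportedDensity a t bm bp vm vp ρ u ρt ρx ux := fun t ht =>
    h.restrict le_rfl ht.1 ht.2 (fun s hs => h.lt s ⟨hs.1, hs.2.trans ht.2⟩) (fun _ _ => le_rfl)
      (h.contRight.mono (Icc_subset_Icc_right ht.2))
      (h.contVelRight.mono (Icc_subset_Icc_right ht.2))
      (fun s hs => h.derivRight s ⟨hs.1, hs.2.trans_le ht.2⟩)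
  have hmoment : ∀ t ∈ Icc a b, ∀ φ φ' : ℝ → ℝ, (∀ x, HasDerivAt φ (φ' x) x) → Continuous φ' →
      (∫ x in bm t..bp t, φ x * ρ t x) - ∫ x in bm a..bp a, φ x * ρ a x
        = ∫ s in a..t, ∫ x in bm s..bp s, φ' x * (ρ s x * u s x) := by
    intro t ht φ φ' hφ hφ'
    rw [(hrest t ht).integral_moment_sub hφ hφ']
    refine intervalIntegral.integral_congr fun s hs => ?_
    rw [uIcc_of_le ht.1] at hs
    have hs' : s ∈ Icc a b := ⟨hs.1, hs.2.trans ht.2⟩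
    simp only [hvm s hs', hvp s hs', sub_self, mul_zero, add_zero]
  have hmass : ∀ t ∈ Icc a b, M t (bp t) = M a (bp a) := by
    intro t ht
    have := hmoment t ht (fun _ => 1) (fun _ => 0) (fun x => hasDerivAt_const x 1) continuous_const
    simp only [one_mul, zero_mul, intervalIntegral.integral_zero, eM] at this
    linarith
  have hfirst : ∀ t ∈ Icc a b, m₁ t - m₁ a = ∫ s in a..t, Q s := by
    intro t ht
    have := hmoment t ht (fun x => x) (fun _ => 1) hasDerivAt_id' continuous_const
    simpa only [one_mul, em₁, eQ] using this
  have hsecond : m₂ b - m₂ a = ∫ s in a..b, 2 * R s := by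
    have := hmoment b hb (fun x => x ^ 2) (fun x => 2 * x)
      (fun x => by simpa using hasDerivAt_pow 2 x) (by fun_prop)
    simpa only [mul_assoc, intervalIntegral.integral_const_mul, em₂, eR] using this
  have hsquare : m₁ b ^ 2 - m₁ a ^ 2 = ∫ s in a..b, 2 * (m₁ s * Q s) := by
    refine (intervalIntegral.integral_eq_sub_of_hasDerivAt_of_le (f := fun t => m₁ t ^ 2) h.le
      (by fun_prop) (fun t ht => ?_)
      (ContinuousOn.intervalIntegrable_of_Icc h.le (by fun_prop))).symm
    have hd : HasDerivAt m₁ (Q t) t := by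
      refine ((hasDerivAt_primitive_of_continuousOn cQ ht).const_add (m₁ a)).congr_of_eventuallyEq ?_
      filter_upwards [Icc_mem_nhds ht.1 ht.2] with s hs
      linarith [hfirst s hs]
    refine (hd.pow 2).congr_deriv ?_
    ring
  let m := M a (bp a)
  have hMx : ∀ t ∈ Icc a b, ∀ x ∈ Ioo (bm t) (bp t), HasDerivAt (M t) (ρ t x) x := by
    intro t ht x hx
    simpa only [eM] using
      hasDerivAt_primitive_of_continuousOn (continuousOn_slice_movingDomain ht cρ) hx
  have hMt : ∀ t ∈ Ioo a b, ∀ x ∈ Ioo (bm t) (bp t),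
      HasDerivAt (fun s => M s x) (-(ρ t x * u t x)) t := by
    intro t ht x hx
    simpa only [eM] using h.hasDerivAt_partial_mass hvm ht hx
  have hMl : ∀ t, M t (bm t) = 0 := fun t => by rw [← eM, intervalIntegral.integral_same]
  have habs : (∫ x in bm b..bp b, M b x * (m - M b x)) - ∫ x in bm a..bp a, M a x * (m - M a x)
      = ∫ s in a..b, ∫ x in bm s..bp s, -(ρ s x * u s x) * (m - 2 * M s x) := by
    rw [integral_moving_interval_sub (f := fun t x => M t x * (m - M t x))
      (ft := fun s x => -(ρ s x * u s x) * (m - 2 * M s x))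
      (fx := fun s x => ρ s x * (m - 2 * M s x)) h.le h.lt h.contLeft h.contRight
      h.contVelLeft h.contVelRight h.derivLeft h.derivRight (by fun_prop) (by fun_prop)
      (by fun_prop)
      (fun t ht x hx => ((hMt t ht x hx).mul ((hMt t ht x hx).const_sub m)).congr_deriv (by ring))
      (fun t ht x hx => ((hMx t (Ioo_subset_Icc_self ht) x hx).mul
        ((hMx t (Ioo_subset_Icc_self ht) x hx).const_sub m)).congr_deriv (by ring))]
    refine intervalIntegral.integral_congr fun s hs => ?_
    rw [uIcc_of_le h.le] at hs
    simp only [hMl, hmass s hs, m, sub_self, mul_zero, zero_mul, add_zero]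
  have hWxeq : ∀ s ∈ Icc a b, EqOn (fun x => ρ s x * u s x * Wx s x)
      (fun x => ρ s x * u s x * (-(2 * M s x - m) + x * m - m₁ s)) (Ioo (bm s) (bp s)) := by
    intro s hs x hx
    have := (hWx s hs x (Ioo_subset_Icc_self hx)).unique
      (hasDerivAt_interaction_potential (continuousOn_slice_movingDomain hs cρ) hx)
    simp only [eM, em₁, hmass s hs] at this
    simp only [this, m]
  have hint : ∀ s ∈ Icc a b, ContinuousOn
      (fun x => ρ s x * u s x * (-(2 * M s x - m) + x * m - m₁ s)) (Icc (bm s) (bp s)) := by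
    intro s hs
    have h1 := continuousOn_slice_movingDomain hs cρ
    have h2 := continuousOn_slice_movingDomain hs cu
    have h3 := continuousOn_slice_movingDomain hs cM
    fun_prop
  let Z : ℝ → ℝ := fun s =>
    m * R s - m₁ s * Q s - ∫ x in bm s..bp s, -(ρ s x * u s x) * (m - 2 * M s x)
  have cZ3 : ContinuousOn (fun s => ∫ x in bm s..bp s, -(ρ s x * u s x) * (m - 2 * M s x))
      (Icc a b) := cI (f := fun s x => -(ρ s x * u s x) * (m - 2 * M s x)) (by fun_prop)
  have hZ : ∀ s ∈ Icc a b, ∫ x in bm s..bp s, ρ s x * u s x * Wx s x = Z s := by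
    intro s hs
    have h1 := continuousOn_slice_movingDomain hs cρ
    have h2 := continuousOn_slice_movingDomain hs cu
    have h3 := continuousOn_slice_movingDomain hs cM
    rw [intervalIntegral.integral_congr_Ioo_of_le (hle s hs) (hWxeq s hs)]
    simp only [Z]
    rw [← eR, ← eQ, ← intervalIntegral.integral_const_mul, ← intervalIntegral.integral_const_mul,
      ← intervalIntegral.integral_sub, ← intervalIntegral.integral_sub]
    · exact intervalIntegral.integral_congr fun x _ => by ring
    all_goals exact ContinuousOn.intervalIntegrable_of_Icc (hle s hs) (by fun_prop)
  refine ⟨?_, fun s hs => ?_, ?_⟩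
  · have : ContinuousOn Z (Icc a b) := by fun_prop
    exact (this.congr hZ).intervalIntegrable_of_Icc h.le
  · refine ((hint s hs).intervalIntegrable_of_Icc (hle s hs)).congr_uIoo ?_
    rw [uIoo_of_le (hle s hs)]
    exact (hWxeq s hs).symm
  · rw [integral_interaction_energy (hle b hb) (continuousOn_slice_movingDomain hb cρ),
      integral_interaction_energy (hle a ha) (continuousOn_slice_movingDomain ha cρ)]
    have hI : ∫ s in a..b, ∫ x in bm s..bp s, ρ s x * u s x * Wx s x = ∫ s in a..b, Z s :=
      intervalIntegral.integral_congr fun s hs => hZ s (by rwa [uIcc_of_le h.le] at hs)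
    have hZint : ∫ s in a..b, Z s = m * (∫ s in a..b, R s) - (∫ s in a..b, m₁ s * Q s)
        - ∫ s in a..b, ∫ x in bm s..bp s, -(ρ s x * u s x) * (m - 2 * M s x) := by
      rw [← intervalIntegral.integral_const_mul, ← intervalIntegral.integral_sub,
        ← intervalIntegral.integral_sub]
      all_goals exact ContinuousOn.intervalIntegrable_of_Icc h.le (by fun_prop)
    rw [intervalIntegral.integral_const_mul] at hsecond hsquare
    rw [hI, hZint, ← habs]
    simp only [eM, em₁, em₂, hmass b hb]
    simp only [m]
    linear_combination (1 / 2) * M a (bp a) * hsecond - (1 / 2) * hsquare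

end TransportedDensity

theorem hasDerivAt_kinetic_add_internal {γ κ t r' v' : ℝ} {r v : ℝ → ℝ} (hγ : 1 < γ)
    (hr : HasDerivAt r r' t) (hv : HasDerivAt v v' t) (hpos : 0 < r t) :
    HasDerivAt (fun s => 1 / 2 * r s * (v s) ^ 2 + r s * (κ * r s ^ (γ - 1) / (γ - 1)))
      (1 / 2 * r' * (v t) ^ 2 + r t * v t * v' + κ / (γ - 1) * γ * r t ^ (γ - 1) * r') t := by
  have hγ' : γ - 1 ≠ 0 := by linarith
  refine (((hr.const_mul (1 / 2)).mul (hv.pow 2)).add (hr.mul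
    (((hr.rpow_const (p := γ - 1) (Or.inl hpos.ne')).const_mul κ).div_const (γ - 1)))).congr_deriv ?_
  have hp : r t ^ (γ - 1) = r t * r t ^ (γ - 1 - 1) := by
    rw [Real.rpow_sub_one hpos.ne' (γ - 1), mul_div_cancel₀ _ hpos.ne']
  simp only [Pi.pow_apply, hp]
  field_simp
  ring

theorem hasDerivAt_stress {γ κ α ε x r' w' : ℝ} {r w : ℝ → ℝ}
    (hr : HasDerivAt r r' x) (hw : HasDerivAt w w' x) (hpos : 0 < r x) :
    HasDerivAt (fun y => κ * r y ^ γ - ε * r y ^ α * w y)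
      (κ * γ * r x ^ (γ - 1) * r' - ε * (α * r x ^ (α - 1) * r' * w x + r x ^ α * w')) x := by
  refine (((hr.rpow_const (p := γ) (Or.inl hpos.ne')).const_mul κ).sub
    (((hr.rpow_const (p := α) (Or.inl hpos.ne')).const_mul ε).mul hw)).congr_deriv ?_
  ring

/-- Basic energy identity for the viscous free-boundary problem (Lemma 3.1), for the
polytropic pressure P(ρ) = κρ^γ with internal energy e(ρ) = κρ^{γ-1}/(γ-1), interaction
potential W(x) = -|x| + x²/2 and communication weight `cw` (bounded, measurable, even,
nonnegative). Here ρt, ρx, ut, ux, uxx denote the classical partial derivatives of ρ and u,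
and Wx denotes ∂ₓ(W∗ρ). -/
theorem basic_energy_identity
    (γ κ α ε lam T : ℝ)
    (hγ : 1 < γ) (hκ : 0 < κ) (hα : 0 ≤ α) (hε : 0 < ε) (hT : 0 < T)
    (cw : ℝ → ℝ) (hcw_meas : Measurable cw) (hcw_bdd : ∃ C : ℝ, ∀ x, |cw x| ≤ C)
    (hcw_even : ∀ x, cw (-x) = cw x) (hcw_nonneg : ∀ x, 0 ≤ cw x)
    (bm bp : ℝ → ℝ) (ρ u ρt ρx ut ux uxx Wx : ℝ → ℝ → ℝ)
    (hb : ∀ t ∈ Set.Icc (0:ℝ) T, bm t < bp t)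
    (hρpos : ∀ t ∈ Set.Icc (0:ℝ) T, ∀ x ∈ Set.Icc (bm t) (bp t), 0 < ρ t x)
    -- classical regularity: partial derivatives on the domain
    (hρt : ∀ t ∈ Set.Icc (0:ℝ) T, ∀ x ∈ Set.Icc (bm t) (bp t),
      HasDerivAt (fun s => ρ s x) (ρt t x) t)
    (hρx : ∀ t ∈ Set.Icc (0:ℝ) T, ∀ x ∈ Set.Icc (bm t) (bp t),
      HasDerivAt (fun y => ρ t y) (ρx t x) x)
    (hut : ∀ t ∈ Set.Icc (0:ℝ) T, ∀ x ∈ Set.Icc (bm t) (bp t),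
      HasDerivAt (fun s => u s x) (ut t x) t)
    (hux : ∀ t ∈ Set.Icc (0:ℝ) T, ∀ x ∈ Set.Icc (bm t) (bp t),
      HasDerivAt (fun y => u t y) (ux t x) x)
    (huxx : ∀ t ∈ Set.Icc (0:ℝ) T, ∀ x ∈ Set.Icc (bm t) (bp t),
      HasDerivAt (fun y => ux t y) (uxx t x) x)
    (hcont : ContinuousOn
      (fun q : ℝ × ℝ => (ρ q.1 q.2, u q.1 q.2, ρt q.1 q.2, ρx q.1 q.2,
        ut q.1 q.2, ux q.1 q.2, uxx q.1 q.2))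
      {q : ℝ × ℝ | q.1 ∈ Set.Icc (0:ℝ) T ∧ q.2 ∈ Set.Icc (bm q.1) (bp q.1)})
    -- Wx is the spatial derivative of the convolution W∗ρ
    (hWx : ∀ t ∈ Set.Icc (0:ℝ) T, ∀ x ∈ Set.Icc (bm t) (bp t),
      HasDerivAt (fun z => ∫ y in bm t..bp t, (-|z - y| + (z - y)^2 / 2) * ρ t y)
        (Wx t x) x)
    -- continuity equation
    (hmass : ∀ t ∈ Set.Icc (0:ℝ) T, ∀ x ∈ Set.Icc (bm t) (bp t),
      ρt t x + (ρx t x * u t x + ρ t x * ux t x) = 0)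
    -- momentum equation
    (hmom : ∀ t ∈ Set.Icc (0:ℝ) T, ∀ x ∈ Set.Icc (bm t) (bp t),
      (ρt t x * u t x + ρ t x * ut t x)
        + (ρx t x * (u t x)^2 + 2 * ρ t x * u t x * ux t x
            + κ * γ * ρ t x ^ (γ - 1) * ρx t x)
      = ε * (α * ρ t x ^ (α - 1) * ρx t x * ux t x + ρ t x ^ α * uxx t x)
        + lam * ρ t x * u t x - ρ t x * Wx t x
        + ρ t x * ∫ y in bm t..bp t, cw (x - y) * (u t y - u t x) * ρ t y)
    -- free-boundary ODEs
    (hbp : ∀ t ∈ Set.Icc (0:ℝ) T, HasDerivAt bp (u t (bp t)) t)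
    (hbm : ∀ t ∈ Set.Icc (0:ℝ) T, HasDerivAt bm (u t (bm t)) t)
    -- stress-free boundary conditions
    (hsfp : ∀ t ∈ Set.Icc (0:ℝ) T,
      κ * ρ t (bp t) ^ γ - ε * ρ t (bp t) ^ α * ux t (bp t) = 0)
    (hsfm : ∀ t ∈ Set.Icc (0:ℝ) T,
      κ * ρ t (bm t) ^ γ - ε * ρ t (bm t) ^ α * ux t (bm t) = 0) :
    ∀ t ∈ Set.Icc (0:ℝ) T,
      (∫ x in bm t..bp t,
          (1/2 * ρ t x * (u t x)^2 + ρ t x * (κ * ρ t x ^ (γ - 1) / (γ - 1))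
            + 1/2 * ρ t x * ∫ y in bm t..bp t, (-|x - y| + (x - y)^2 / 2) * ρ t y))
      + (∫ s in (0:ℝ)..t, ∫ x in bm s..bp s,
          (ε * ρ s x ^ α * (ux s x)^2 - lam * ρ s x * (u s x)^2))
      + 1/2 * (∫ s in (0:ℝ)..t, ∫ x in bm s..bp s, ∫ y in bm s..bp s,
          cw (x - y) * ρ s x * ρ s y * (u s y - u s x)^2)
      = ∫ x in (bm 0)..(bp 0),
          (1/2 * ρ 0 x * (u 0 x)^2 + ρ 0 x * (κ * ρ 0 x ^ (γ - 1) / (γ - 1))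
            + 1/2 * ρ 0 x * ∫ y in (bm 0)..(bp 0), (-|x - y| + (x - y)^2 / 2) * ρ 0 y) := by
  intro t ht
  have hsub : Icc 0 t ⊆ Icc 0 T := Icc_subset_Icc_right ht.2
  have hto : Ioo 0 t ⊆ Icc 0 T := Ioo_subset_Icc_self.trans hsub
  have hcont' := hcont.mono fun q (hq : q ∈ movingDomain 0 t bm bp) => ⟨hsub hq.1, hq.2⟩
  have cρ : ContinuousOn (fun q : ℝ × ℝ => ρ q.1 q.2) (movingDomain 0 t bm bp) := hcont'.fst
  have cu : ContinuousOn (fun q : ℝ × ℝ => u q.1 q.2) (movingDomain 0 t bm bp) := hcont'.snd.fst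
  have cρt : ContinuousOn (fun q : ℝ × ℝ => ρt q.1 q.2) (movingDomain 0 t bm bp) :=
    hcont'.snd.snd.fst
  have cρx : ContinuousOn (fun q : ℝ × ℝ => ρx q.1 q.2) (movingDomain 0 t bm bp) :=
    hcont'.snd.snd.snd.fst
  have cut : ContinuousOn (fun q : ℝ × ℝ => ut q.1 q.2) (movingDomain 0 t bm bp) :=
    hcont'.snd.snd.snd.snd.fst
  have cux : ContinuousOn (fun q : ℝ × ℝ => ux q.1 q.2) (movingDomain 0 t bm bp) :=
    hcont'.snd.snd.snd.snd.snd.fst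
  have cuxx : ContinuousOn (fun q : ℝ × ℝ => uxx q.1 q.2) (movingDomain 0 t bm bp) :=
    hcont'.snd.snd.snd.snd.snd.snd
  have cpow : ∀ p : ℝ,
      ContinuousOn (fun q : ℝ × ℝ => ρ q.1 q.2 ^ p) (movingDomain 0 t bm bp) := fun p =>
    cρ.rpow_const fun q (hq : q ∈ movingDomain 0 t bm bp) =>
      Or.inl (hρpos q.1 (hsub hq.1) q.2 hq.2).ne'
  have cbm : ContinuousOn bm (Icc 0 t) := fun s hs =>
    (hbm s (hsub hs)).continuousAt.continuousWithinAt
  have cbp : ContinuousOn bp (Icc 0 t) := fun s hs =>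
    (hbp s (hsub hs)).continuousAt.continuousWithinAt
  have hlt : ∀ s ∈ Icc 0 t, bm s < bp s := fun s hs => hb s (hsub hs)
  have hle : ∀ s ∈ Icc 0 t, bm s ≤ bp s := fun s hs => (hlt s hs).le
  have ctrm : ∀ {f : ℝ → ℝ → ℝ},
      ContinuousOn (fun q : ℝ × ℝ => f q.1 q.2) (movingDomain 0 t bm bp) →
      ContinuousOn (fun s => f s (bm s)) (Icc 0 t) := fun hf =>
    hf.comp (continuousOn_id.prodMk cbm) fun s hs => ⟨hs, le_rfl, hle s hs⟩
  have ctrp : ∀ {f : ℝ → ℝ → ℝ},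
      ContinuousOn (fun q : ℝ × ℝ => f q.1 q.2) (movingDomain 0 t bm bp) →
      ContinuousOn (fun s => f s (bp s)) (Icc 0 t) := fun hf =>
    hf.comp (continuousOn_id.prodMk cbp) fun s hs => ⟨hs, hle s hs, le_rfl⟩
  have hflow : TransportedDensity 0 t bm bp (fun s => u s (bm s)) (fun s => u s (bp s))
      ρ u ρt ρx ux :=
    { le := ht.1
      lt := hlt
      contLeft := cbm
      contRight := cbp
      contVelLeft := ctrm cu
      contVelRight := ctrp cu
      derivLeft := fun s hs => hbm s (hto hs)
      derivRight := fun s hs => hbp s (hto hs)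
      contDensity := cρ
      contVelocity := cu
      contDensityTime := cρt
      contDensitySpace := cρx
      contVelocitySpace := cux
      derivDensityTime := fun s hs => hρt s (hsub hs)
      derivDensitySpace := fun s hs => hρx s (hsub hs)
      derivVelocitySpace := fun s hs => hux s (hsub hs)
      continuity := fun s hs => hmass s (hsub hs) }
  obtain ⟨hZint, hZslice, hpotential⟩ := hflow.integral_interaction_energy_sub
    (fun _ _ => rfl) (fun _ _ => rfl) (fun s hs => hWx s (hsub hs))
  let f : ℝ → ℝ → ℝ := fun s x =>
    1 / 2 * ρ s x * (u s x) ^ 2 + ρ s x * (κ * ρ s x ^ (γ - 1) / (γ - 1))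
  let ft : ℝ → ℝ → ℝ := fun s x => 1 / 2 * ρt s x * (u s x) ^ 2 + ρ s x * u s x * ut s x
    + κ / (γ - 1) * γ * ρ s x ^ (γ - 1) * ρt s x
  let fx : ℝ → ℝ → ℝ := fun s x => 1 / 2 * ρx s x * (u s x) ^ 2 + ρ s x * u s x * ux s x
    + κ / (γ - 1) * γ * ρ s x ^ (γ - 1) * ρx s x
  let stress : ℝ → ℝ → ℝ := fun s x => κ * ρ s x ^ γ - ε * ρ s x ^ α * ux s x
  let stressx : ℝ → ℝ → ℝ := fun s x => κ * γ * ρ s x ^ (γ - 1) * ρx s x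
    - ε * (α * ρ s x ^ (α - 1) * ρx s x * ux s x + ρ s x ^ α * uxx s x)
  let diss : ℝ → ℝ → ℝ := fun s x => ε * ρ s x ^ α * (ux s x) ^ 2 - lam * ρ s x * (u s x) ^ 2
  let align : ℝ → ℝ → ℝ := fun s x =>
    ρ s x * u s x * ∫ y in bm s..bp s, cw (x - y) * (u s y - u s x) * ρ s y
  have cp1 := cpow (γ - 1)
  have cp2 := cpow γ
  have cp3 := cpow α
  have cp4 := cpow (α - 1)
  have cf : ContinuousOn (fun q : ℝ × ℝ => f q.1 q.2) (movingDomain 0 t bm bp) := by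
    fun_prop
  have cft : ContinuousOn (fun q : ℝ × ℝ => ft q.1 q.2) (movingDomain 0 t bm bp) := by
    fun_prop
  have cfx : ContinuousOn (fun q : ℝ × ℝ => fx q.1 q.2) (movingDomain 0 t bm bp) := by
    fun_prop
  have cstress : ContinuousOn (fun q : ℝ × ℝ => stress q.1 q.2) (movingDomain 0 t bm bp) := by
    fun_prop
  have cstressx : ContinuousOn (fun q : ℝ × ℝ => stressx q.1 q.2) (movingDomain 0 t bm bp) := by
    fun_prop
  have cdiss : ContinuousOn (fun q : ℝ × ℝ => diss q.1 q.2) (movingDomain 0 t bm bp) := by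
    fun_prop
  have dft : ∀ s ∈ Icc 0 t, ∀ x ∈ Icc (bm s) (bp s), HasDerivAt (fun τ => f τ x) (ft s x) s :=
    fun s hs x hx => hasDerivAt_kinetic_add_internal hγ (hρt s (hsub hs) x hx)
      (hut s (hsub hs) x hx) (hρpos s (hsub hs) x hx)
  have dfx : ∀ s ∈ Icc 0 t, ∀ x ∈ Icc (bm s) (bp s), HasDerivAt (f s) (fx s x) x :=
    fun s hs x hx => hasDerivAt_kinetic_add_internal hγ (hρx s (hsub hs) x hx)
      (hux s (hsub hs) x hx) (hρpos s (hsub hs) x hx)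
  have dstress : ∀ s ∈ Icc 0 t, ∀ x ∈ Icc (bm s) (bp s),
      HasDerivAt (stress s) (stressx s x) x :=
    fun s hs x hx => hasDerivAt_stress (hρx s (hsub hs) x hx)
      (huxx s (hsub hs) x hx) (hρpos s (hsub hs) x hx)
  have hbalance : ∀ s ∈ Icc 0 t, ∀ x ∈ Icc (bm s) (bp s),
      ft s x + (fx s x * u s x + f s x * ux s x + (stressx s x * u s x + stress s x * ux s x))
        = align s x - diss s x - ρ s x * u s x * Wx s x := by
    intro s hs x hx
    have hpos := hρpos s (hsub hs) x hx
    have hγ' : γ - 1 ≠ 0 := by linarith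
    have hpow : ρ s x ^ γ = ρ s x * ρ s x ^ (γ - 1) := by
      rw [Real.rpow_sub_one hpos.ne']
      field_simp
    have hκ' : κ = κ / (γ - 1) * (γ - 1) := by field_simp
    have hf : f s x = 1 / 2 * ρ s x * (u s x) ^ 2 + ρ s x * (κ / (γ - 1) * ρ s x ^ (γ - 1)) := by
      simp only [f]
      ring
    rw [hf]
    simp only [ft, fx, stress, stressx, diss, align, hpow]
    linear_combination u s x * hmom s (hsub hs) x hx
      + (-(1 / 2) * (u s x) ^ 2 + κ / (γ - 1) * γ * ρ s x ^ (γ - 1)) * hmass s (hsub hs) x hx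
      + ρ s x * ρ s x ^ (γ - 1) * ux s x * hκ'
  have hrate : ∀ s ∈ Icc 0 t,
      (∫ x in bm s..bp s, ft s x) + (f s (bp s) * u s (bp s) - f s (bm s) * u s (bm s))
        = -(∫ x in bm s..bp s, diss s x) - (∫ x in bm s..bp s, ρ s x * u s x * Wx s x)
          - 1 / 2 * ∫ x in bm s..bp s, ∫ y in bm s..bp s,
            cw (x - y) * ρ s x * ρ s y * (u s y - u s x) ^ 2 := by
    intro s hs
    have slice : ∀ {g : ℝ → ℝ → ℝ},
        ContinuousOn (fun q : ℝ × ℝ => g q.1 q.2) (movingDomain 0 t bm bp) →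
        ContinuousOn (g s) (Icc (bm s) (bp s)) := fun hg => continuousOn_slice_movingDomain hs hg
    have s1 := slice cρ
    have s2 := slice cu
    have s3 := slice cux
    have s4 := slice cf
    have s5 := slice cfx
    have s6 := slice cstress
    have s7 := slice cstressx
    have hint : ∀ {g : ℝ → ℝ}, ContinuousOn g (Icc (bm s) (bp s)) →
        IntervalIntegrable g volume (bm s) (bp s) := fun hg => hg.intervalIntegrable_of_Icc (hle s hs)
    have hflux : ContinuousOn (fun x => fx s x * u s x + f s x * ux s x
        + (stressx s x * u s x + stress s x * ux s x)) (Icc (bm s) (bp s)) := by fun_prop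
    have hftc := intervalIntegral.integral_eq_sub_of_hasDerivAt_of_le
      (f := fun x => f s x * u s x + stress s x * u s x) (hle s hs) (by fun_prop)
      (fun x hx => ((dfx s hs x (Ioo_subset_Icc_self hx)).mul
        (hux s (hsub hs) x (Ioo_subset_Icc_self hx))).add
        ((dstress s hs x (Ioo_subset_Icc_self hx)).mul
          (hux s (hsub hs) x (Ioo_subset_Icc_self hx)))) (hint hflux)
    have hp0 : stress s (bp s) = 0 := hsfp s (hsub hs)
    have hm0 : stress s (bm s) = 0 := hsfm s (hsub hs)
    simp only [hp0, hm0, zero_mul, add_zero] at hftc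
    obtain ⟨hai, hae⟩ := integral_alignment_symmetrization (hle s hs) hcw_meas hcw_bdd hcw_even s1 s2
    rw [← hftc, ← intervalIntegral.integral_add (hint (slice cft)) (hint hflux)]
    have hcongr := intervalIntegral.integral_congr (a := bm s) (b := bp s) (μ := volume)
      (f := fun x => ft s x + (fx s x * u s x + f s x * ux s x
        + (stressx s x * u s x + stress s x * ux s x)))
      (g := fun x => align s x - diss s x - ρ s x * u s x * Wx s x) fun x hx =>
        hbalance s hs x (by rwa [uIcc_of_le (hle s hs)] at hx)
    rw [hcongr, intervalIntegral.integral_sub (hai.sub (hint (slice cdiss))) (hZslice s hs),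
      intervalIntegral.integral_sub hai (hint (slice cdiss)), hae]
    ring
  have hevol := integral_moving_interval_sub ht.1 hlt cbm cbp (ctrm cu) (ctrp cu)
    (fun s hs => hbm s (hto hs)) (fun s hs => hbp s (hto hs)) cf cft cfx
    (fun s hs x hx => dft s (Ioo_subset_Icc_self hs) x (Ioo_subset_Icc_self hx))
    (fun s hs x hx => dfx s (Ioo_subset_Icc_self hs) x (Ioo_subset_Icc_self hx))
  have hratei : IntervalIntegrable (fun s => (∫ x in bm s..bp s, ft s x)
      + (f s (bp s) * u s (bp s) - f s (bm s) * u s (bm s))) volume 0 t :=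
    ((continuousOn_integral_movingDomain ht.1 hle cbm cbp cft).add
      (((ctrp cf).mul (ctrp cu)).sub ((ctrm cf).mul (ctrm cu)))).intervalIntegrable_of_Icc ht.1
  have hdissi : IntervalIntegrable (fun s => ∫ x in bm s..bp s, diss s x) volume 0 t :=
    (continuousOn_integral_movingDomain ht.1 hle cbm cbp cdiss).intervalIntegrable_of_Icc ht.1
  have haligni : ∫ s in (0 : ℝ)..t, ((∫ x in bm s..bp s, ft s x)
      + (f s (bp s) * u s (bp s) - f s (bm s) * u s (bm s)))
      + (∫ x in bm s..bp s, diss s x) + (∫ x in bm s..bp s, ρ s x * u s x * Wx s x)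
      = -(1 / 2) * ∫ s in (0 : ℝ)..t, ∫ x in bm s..bp s, ∫ y in bm s..bp s,
            cw (x - y) * ρ s x * ρ s y * (u s y - u s x) ^ 2 := by
    rw [← intervalIntegral.integral_const_mul]
    refine intervalIntegral.integral_congr fun s hs => ?_
    rw [uIcc_of_le ht.1] at hs
    simp only [hrate s hs]
    ring
  rw [intervalIntegral.integral_add (hratei.add hdissi) hZint,
    intervalIntegral.integral_add hratei hdissi, ← hevol, ← hpotential] at haligni
  have henergy : ∀ s ∈ Icc 0 t, ∫ x in bm s..bp s, (f s x
      + 1 / 2 * ρ s x * ∫ y in bm s..bp s, (-|x - y| + (x - y) ^ 2 / 2) * ρ s y)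
      = (∫ x in bm s..bp s, f s x) + ∫ x in bm s..bp s,
        1 / 2 * ρ s x * ∫ y in bm s..bp s, (-|x - y| + (x - y) ^ 2 / 2) * ρ s y := by
    intro s hs
    have s1 := continuousOn_slice_movingDomain hs cρ
    have s2 := continuousOn_interaction_potential (hle s hs) s1
    exact intervalIntegral.integral_add
      ((continuousOn_slice_movingDomain hs cf).intervalIntegrable_of_Icc (hle s hs))
      (ContinuousOn.intervalIntegrable_of_Icc (hle s hs) (by fun_prop))
  have e1 := henergy t (right_mem_Icc.2 ht.1)
  have e0 := henergy 0 (left_mem_Icc.2 ht.1)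
  simp only [f, diss] at e1 e0 haligni
  rw [e1, e0]
  linear_combination haligni
end

section
/- Second moment estimate (Lemma 3.2): Let b⁻, b⁺ : [0,T] → ℝ be C¹ with b⁻(t) < b⁺(t), and let ρ > 0 and u be C¹ functions on Ω_T = {(t,x) : 0 ≤ t ≤ T, b⁻(t) ≤ x ≤ b⁺(t)} satisfying the continuity equation ρ_t + (ρu)_x = 0 on Ω_T and the boundary ODEs (b±)'(t) = u(t, b±(t)). Assume there is E ≥ 0 such that ∫_{b⁻(s)}^{b⁺(s)} ρ(s,x) u(s,x)² dx ≤ E for all s ∈ [0,T]. Then for every t ∈ [0,T], ∫_{b⁻(t)}^{b⁺(t)} x² ρ(t,x) dx ≤ e^t ( ∫_{b⁻(0)}^{b⁺(0)} x² ρ(0,x) dx + E ). -/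
open Real MeasureTheory Set

/-- Chain rule along a curve for a function of two real variables with continuous partials. -/
lemma hasDerivAt_comp_curve_of_partials {f f₁ f₂ : ℝ → ℝ → ℝ} {X : ℝ → ℝ} {X' t : ℝ}
    {S : Set (ℝ × ℝ)} (hS : S ∈ nhds (t, X t))
    (h₁ : ∀ v ∈ S, HasDerivAt (fun s => f s v.2) (f₁ v.1 v.2) v.1)
    (h₂ : ∀ v ∈ S, HasDerivAt (fun y => f v.1 y) (f₂ v.1 v.2) v.2)
    (c₁ : ContinuousOn (fun v : ℝ × ℝ => f₁ v.1 v.2) S)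
    (c₂ : ContinuousOn (fun v : ℝ × ℝ => f₂ v.1 v.2) S) (hX : HasDerivAt X X' t) :
    HasDerivAt (fun s => f s (X s)) (f₁ t (X t) + f₂ t (X t) * X') t := by
  have hstrict := hasStrictFDerivAt_uncurry_coprod (𝕜 := ℝ) (u := (t, X t)) (f := f)
    (f₁ := fun a b => ContinuousLinearMap.toSpanSingleton ℝ (f₁ a b))
    (f₂ := fun a b => ContinuousLinearMap.toSpanSingleton ℝ (f₂ a b))
    (Filter.mem_of_superset hS fun v hv => (h₁ v hv).hasFDerivAt)
    (Filter.mem_of_superset hS fun v hv => (h₂ v hv).hasFDerivAt)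
    ((ContinuousLinearMap.toSpanSingletonCLE (𝕜 := ℝ) (E := ℝ)).continuous.continuousAt.comp
      (c₁.continuousAt hS))
    ((ContinuousLinearMap.toSpanSingletonCLE (𝕜 := ℝ) (E := ℝ)).continuous.continuousAt.comp
      (c₂.continuousAt hS))
  have hcurve : HasDerivAt (fun s => (s, X s)) (1, X') t := (hasDerivAt_id t).prodMk hX
  refine (hstrict.hasFDerivAt.comp_hasDerivAt t hcurve).congr_deriv ?_
  simp [Function.HasUncurry.uncurry, mul_comm]

/-- An interval integral is continuous in its parameter if the integrand is continuous on a
compact rectangle. -/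
lemma continuousOn_intervalIntegral_of_rectangle {T : ℝ} {G : ℝ → ℝ → ℝ}
    (hG : ContinuousOn (fun q : ℝ × ℝ => G q.1 q.2) (Icc 0 T ×ˢ Icc 0 1)) :
    ContinuousOn (fun t => ∫ y in (0:ℝ)..1, G t y) (Icc 0 T) := by
  obtain ⟨C, hC⟩ := (isCompact_Icc.prod isCompact_Icc).exists_bound_of_continuousOn hG
  intro t ht
  have hI : uIoc (0:ℝ) 1 ⊆ Icc 0 1 := by
    rw [uIoc_of_le zero_le_one]; exact Ioc_subset_Icc_self
  refine intervalIntegral.continuousWithinAt_of_dominated_interval (bound := fun _ => C)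
    ?_ ?_ (by simp) ?_
  · filter_upwards [self_mem_nhdsWithin] with s hs
    exact (hG.comp (f := fun y : ℝ => (s, y)) (by fun_prop) fun y hy => ⟨hs, hI hy⟩ :
      ContinuousOn (fun y => G s y) (uIoc 0 1)).aestronglyMeasurable measurableSet_uIoc
  · filter_upwards [self_mem_nhdsWithin] with s hs
    exact .of_forall fun y hy => hC (s, y) ⟨hs, hI hy⟩
  · refine .of_forall fun y hy => ?_
    exact (hG.comp (f := fun s : ℝ => (s, y)) (by fun_prop) fun s hs => ⟨hs, hI hy⟩ :
      ContinuousOn (fun s => G s y) (Icc 0 T)) t ht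

/-- Differentiation under the integral sign for integrands with derivative continuous on a
compact rectangle. -/
lemma hasDerivAt_intervalIntegral_of_rectangle {T : ℝ} {G D : ℝ → ℝ → ℝ}
    (hG : ContinuousOn (fun q : ℝ × ℝ => G q.1 q.2) (Icc 0 T ×ˢ Icc 0 1))
    (hD : ContinuousOn (fun q : ℝ × ℝ => D q.1 q.2) (Icc 0 T ×ˢ Icc 0 1))
    (hGD : ∀ t ∈ Ioo 0 T, ∀ y ∈ Ioo (0:ℝ) 1, HasDerivAt (fun s => G s y) (D t y) t)
    {t : ℝ} (ht : t ∈ Ioo 0 T) :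
    HasDerivAt (fun s => ∫ y in (0:ℝ)..1, G s y) (∫ y in (0:ℝ)..1, D t y) t := by
  obtain ⟨C, hC⟩ := (isCompact_Icc.prod isCompact_Icc).exists_bound_of_continuousOn hD
  have hI : uIoc (0:ℝ) 1 ⊆ Icc 0 1 := by
    rw [uIoc_of_le zero_le_one]; exact Ioc_subset_Icc_self
  have slice {F : ℝ → ℝ → ℝ}
      (hF : ContinuousOn (fun q : ℝ × ℝ => F q.1 q.2) (Icc 0 T ×ˢ Icc 0 1)) {s : ℝ}
      (hs : s ∈ Ioo 0 T) : ContinuousOn (fun y => F s y) (Icc 0 1) :=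
    hF.comp (f := fun y : ℝ => (s, y)) (by fun_prop) fun y hy => ⟨Ioo_subset_Icc_self hs, hy⟩
  have hs := Ioo_mem_nhds ht.1 ht.2
  refine (intervalIntegral.hasDerivAt_integral_of_dominated_loc_of_deriv_le
    (bound := fun _ => C) (F' := D) hs ?_ ?_ ?_ ?_ (by simp) ?_).2
  · filter_upwards [hs] with s hs
    exact ((slice hG hs).mono hI).aestronglyMeasurable measurableSet_uIoc
  · exact (slice hG ht).intervalIntegrable_of_Icc zero_le_one
  · exact ((slice hD ht).mono hI).aestronglyMeasurable measurableSet_uIoc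
  · exact .of_forall fun y hy s hs => hC (s, y) ⟨Ioo_subset_Icc_self hs, hI hy⟩
  · filter_upwards [Measure.ae_ne volume (1:ℝ)] with y hy1 hy s hs
    rw [uIoc_of_le zero_le_one] at hy
    exact hGD s hs y ⟨hy.1, lt_of_le_of_ne hy.2 hy1⟩

/-- Gronwall's inequality for `f' ≤ f + E`. -/
lemma add_le_exp_mul_of_deriv_le {T E : ℝ} {f f' : ℝ → ℝ} (hf : ContinuousOn f (Icc 0 T))
    (hf' : ∀ t ∈ Ioo 0 T, HasDerivAt f (f' t) t) (hle : ∀ t ∈ Ioo 0 T, f' t ≤ f t + E)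
    {t : ℝ} (ht : t ∈ Icc 0 T) : f t + E ≤ Real.exp t * (f 0 + E) := by
  have hder : ∀ s ∈ Ioo 0 T, HasDerivAt (fun s => Real.exp (-s) * (f s + E))
      (Real.exp (-s) * (-1) * (f s + E) + Real.exp (-s) * f' s) s := fun s hs =>
    ((hasDerivAt_neg s).exp).mul ((hf' s hs).add_const E)
  have hanti : AntitoneOn (fun s => Real.exp (-s) * (f s + E)) (Icc 0 T) := by
    refine antitoneOn_of_deriv_nonpos (convex_Icc 0 T) (by fun_prop) ?_ ?_ <;>
      rw [interior_Icc]
    · exact fun s hs => (hder s hs).differentiableAt.differentiableWithinAt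
    · intro s hs
      rw [(hder s hs).deriv]
      nlinarith [Real.exp_pos (-s), hle s hs]
  have h := hanti (left_mem_Icc.2 (ht.1.trans ht.2)) ht ht.1
  simp only [neg_zero, Real.exp_zero, one_mul] at h
  calc f t + E = Real.exp t * (Real.exp (-t) * (f t + E)) := by
        rw [← mul_assoc, ← Real.exp_add]; simp
    _ ≤ _ := by gcongr

/-- Second moment estimate (Lemma 3.2): for C¹ solutions of the continuity equation on
the time-dependent domain Ω_T with boundary ODEs, if ∫ ρu² dx ≤ E uniformly in time, then
∫ x²ρ(t) dx ≤ e^t (∫ x²ρ(0) dx + E). -/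
theorem second_moment_estimate
    (T E : ℝ) (hT : 0 < T) (hE : 0 ≤ E)
    (bm bp : ℝ → ℝ) (ρ u ρt ρx ut ux : ℝ → ℝ → ℝ)
    (hb : ∀ t ∈ Set.Icc (0:ℝ) T, bm t < bp t)
    (hρpos : ∀ t ∈ Set.Icc (0:ℝ) T, ∀ x ∈ Set.Icc (bm t) (bp t), 0 < ρ t x)
    (hρt : ∀ t ∈ Set.Icc (0:ℝ) T, ∀ x ∈ Set.Icc (bm t) (bp t),
      HasDerivAt (fun s => ρ s x) (ρt t x) t)
    (hρx : ∀ t ∈ Set.Icc (0:ℝ) T, ∀ x ∈ Set.Icc (bm t) (bp t),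
      HasDerivAt (fun y => ρ t y) (ρx t x) x)
    (hut : ∀ t ∈ Set.Icc (0:ℝ) T, ∀ x ∈ Set.Icc (bm t) (bp t),
      HasDerivAt (fun s => u s x) (ut t x) t)
    (hux : ∀ t ∈ Set.Icc (0:ℝ) T, ∀ x ∈ Set.Icc (bm t) (bp t),
      HasDerivAt (fun y => u t y) (ux t x) x)
    (hcont : ContinuousOn
      (fun q : ℝ × ℝ => (ρ q.1 q.2, u q.1 q.2, ρt q.1 q.2, ρx q.1 q.2, ut q.1 q.2, ux q.1 q.2))
      {q : ℝ × ℝ | q.1 ∈ Set.Icc (0:ℝ) T ∧ q.2 ∈ Set.Icc (bm q.1) (bp q.1)})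
    (hmass : ∀ t ∈ Set.Icc (0:ℝ) T, ∀ x ∈ Set.Icc (bm t) (bp t),
      ρt t x + (ρx t x * u t x + ρ t x * ux t x) = 0)
    (hbp : ∀ t ∈ Set.Icc (0:ℝ) T, HasDerivAt bp (u t (bp t)) t)
    (hbm : ∀ t ∈ Set.Icc (0:ℝ) T, HasDerivAt bm (u t (bm t)) t)
    (hkin : ∀ s ∈ Set.Icc (0:ℝ) T, (∫ x in bm s..bp s, ρ s x * (u s x)^2) ≤ E) :
    ∀ t ∈ Set.Icc (0:ℝ) T,
      (∫ x in bm t..bp t, x^2 * ρ t x)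
        ≤ Real.exp t * ((∫ x in (bm 0)..(bp 0), x^2 * ρ 0 x) + E) := by
  set S : Set (ℝ × ℝ) := {q | q.1 ∈ Set.Icc (0:ℝ) T ∧ q.2 ∈ Set.Icc (bm q.1) (bp q.1)}
  have cρ : ContinuousOn (fun q : ℝ × ℝ => ρ q.1 q.2) S := hcont.fst
  have cu : ContinuousOn (fun q : ℝ × ℝ => u q.1 q.2) S := hcont.snd.fst
  have cρt : ContinuousOn (fun q : ℝ × ℝ => ρt q.1 q.2) S := hcont.snd.snd.fst
  have cρx : ContinuousOn (fun q : ℝ × ℝ => ρx q.1 q.2) S := hcont.snd.snd.snd.fst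
  have cbm : ContinuousOn bm (Icc 0 T) := fun t ht => (hbm t ht).continuousAt.continuousWithinAt
  have cbp : ContinuousOn bp (Icc 0 T) := fun t ht => (hbp t ht).continuousAt.continuousWithinAt
  have cum : ContinuousOn (fun t => u t (bm t)) (Icc 0 T) :=
    cu.comp (f := fun t => (t, bm t)) (by fun_prop) fun t ht => ⟨ht, left_mem_Icc.2 (hb t ht).le⟩
  have cup : ContinuousOn (fun t => u t (bp t)) (Icc 0 T) :=
    cu.comp (f := fun t => (t, bp t)) (by fun_prop) fun t ht => ⟨ht, right_mem_Icc.2 (hb t ht).le⟩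
  set L : ℝ → ℝ := fun t => bp t - bm t with hL
  set V : ℝ → ℝ := fun t => u t (bp t) - u t (bm t) with hV
  set X : ℝ → ℝ → ℝ := fun t y => bm t + L t * y with hX
  set W : ℝ → ℝ → ℝ := fun t y => u t (bm t) + V t * y with hW
  set R : Set (ℝ × ℝ) := Icc 0 T ×ˢ Icc 0 1
  have hXmem : ∀ t ∈ Icc 0 T, ∀ y ∈ Icc (0:ℝ) 1, X t y ∈ Icc (bm t) (bp t) := by
    intro t ht y hy
    have := hb t ht
    simp only [hX, hL]
    constructor <;> nlinarith [hy.1, hy.2]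
  have onR {f : ℝ → ℝ} (hf : ContinuousOn f (Icc 0 T)) :
      ContinuousOn (fun q : ℝ × ℝ => f q.1) R :=
    hf.comp continuousOn_fst fun q hq => hq.1
  have cLR : ContinuousOn (fun q : ℝ × ℝ => L q.1) R := onR (cbp.sub cbm)
  have cVR : ContinuousOn (fun q : ℝ × ℝ => V q.1) R := onR (cup.sub cum)
  have cXR : ContinuousOn (fun q : ℝ × ℝ => X q.1 q.2) R :=
    (onR cbm).add (cLR.mul continuousOn_snd)
  have cWR : ContinuousOn (fun q : ℝ × ℝ => W q.1 q.2) R :=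
    (onR cum).add (cVR.mul continuousOn_snd)
  have pull {f : ℝ → ℝ → ℝ} (hf : ContinuousOn (fun q : ℝ × ℝ => f q.1 q.2) S) :
      ContinuousOn (fun q : ℝ × ℝ => f q.1 (X q.1 q.2)) R :=
    hf.comp (f := fun q : ℝ × ℝ => (q.1, X q.1 q.2)) (continuousOn_fst.prodMk cXR)
      fun q hq => ⟨hq.1, hXmem _ hq.1 _ hq.2⟩
  have cρR := pull cρ
  have cuR := pull cu
  have cρtR := pull cρt
  have cρxR := pull cρx
  have slice {f : ℝ → ℝ → ℝ} (hf : ContinuousOn (fun q : ℝ × ℝ => f q.1 q.2) R) {t : ℝ}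
      (ht : t ∈ Icc 0 T) : IntervalIntegrable (fun y => f t y) volume 0 1 :=
    (hf.comp (f := fun y : ℝ => (t, y)) (by fun_prop) fun y hy => ⟨ht, hy⟩ :
      ContinuousOn (fun y => f t y) (Icc 0 1)).intervalIntegrable_of_Icc zero_le_one
  have subst (f : ℝ → ℝ → ℝ) (t : ℝ) :
      ∫ x in bm t..bp t, f t x = ∫ y in (0:ℝ)..1, L t * f t (X t y) := by
    rw [intervalIntegral.integral_const_mul]
    simp [hX, hL]
  set G : ℝ → ℝ → ℝ := fun t y => L t * (X t y ^ 2 * ρ t (X t y)) with hG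
  set D : ℝ → ℝ → ℝ := fun t y => V t * (X t y ^ 2 * ρ t (X t y)) +
    L t * (2 * X t y * W t y * ρ t (X t y) +
      X t y ^ 2 * (ρt t (X t y) + ρx t (X t y) * W t y)) with hD
  have cGR : ContinuousOn (fun q : ℝ × ℝ => G q.1 q.2) R :=
    cLR.mul ((cXR.pow 2).mul cρR)
  have cDR : ContinuousOn (fun q : ℝ × ℝ => D q.1 q.2) R :=
    (cVR.mul ((cXR.pow 2).mul cρR)).add (cLR.mul ((((continuousOn_const.mul cXR).mul cWR).mul
      cρR).add ((cXR.pow 2).mul (cρtR.add (cρxR.mul cWR)))))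
  have cPR : ContinuousOn
      (fun q : ℝ × ℝ => L q.1 * (2 * X q.1 q.2 * ρ q.1 (X q.1 q.2) * u q.1 (X q.1 q.2))) R :=
    cLR.mul (((continuousOn_const.mul cXR).mul cρR).mul cuR)
  have iP : ∀ t ∈ Icc 0 T, IntervalIntegrable
      (fun y => L t * (2 * X t y * ρ t (X t y) * u t (X t y))) volume 0 1 := fun t ht =>
    slice (f := fun t y => L t * (2 * X t y * ρ t (X t y) * u t (X t y))) cPR ht
  have hLt : ∀ t ∈ Icc 0 T, HasDerivAt L (V t) t := fun t ht => (hbp t ht).sub (hbm t ht)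
  have hXt : ∀ t ∈ Icc 0 T, ∀ y, HasDerivAt (fun s => X s y) (W t y) t := fun t ht y =>
    (hbm t ht).add ((hLt t ht).mul_const y)
  have hS : ∀ t ∈ Ioo 0 T, ∀ y ∈ Ioo (0:ℝ) 1, S ∈ nhds (t, X t y) := by
    intro t ht y hy
    have ht' := Ioo_subset_Icc_self ht
    have hlt := hb t ht'
    have e1 : bm t < X t y := by simp only [hX, hL]; nlinarith [hy.1]
    have e2 : X t y < bp t := by simp only [hX, hL]; nlinarith [hy.2]
    have t1 : ContinuousAt (fun q : ℝ × ℝ => bm q.1) (t, X t y) :=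
      ContinuousAt.comp (f := Prod.fst) (hbm t ht').continuousAt continuousAt_fst
    have t2 : ContinuousAt (fun q : ℝ × ℝ => bp q.1) (t, X t y) :=
      ContinuousAt.comp (f := Prod.fst) (hbp t ht').continuousAt continuousAt_fst
    filter_upwards [continuousAt_fst.preimage_mem_nhds (Icc_mem_nhds ht.1 ht.2),
      t1.eventually_lt continuousAt_snd e1, continuousAt_snd.eventually_lt t2 e2] with q h0 h1 h2
    exact ⟨h0, h1.le, h2.le⟩
  have hGD : ∀ t ∈ Ioo 0 T, ∀ y ∈ Ioo (0:ℝ) 1, HasDerivAt (fun s => G s y) (D t y) t := by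
    intro t ht y hy
    have ht' := Ioo_subset_Icc_self ht
    have hρX := hasDerivAt_comp_curve_of_partials (X := fun s => X s y) (hS t ht y hy)
      (fun v hv => hρt v.1 hv.1 v.2 hv.2) (fun v hv => hρx v.1 hv.1 v.2 hv.2) cρt cρx
      (hXt t ht' y)
    refine ((hLt t ht').mul (((hXt t ht' y).pow 2).mul hρX)).congr_deriv ?_
    simp only [hD, Pi.pow_apply, Pi.mul_apply]
    push_cast
    ring
  have hflux : ∀ t ∈ Icc 0 T,
      ∫ y in (0:ℝ)..1, D t y = ∫ y in (0:ℝ)..1, L t * (2 * X t y * ρ t (X t y) * u t (X t y)) := by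
    intro t ht
    have iD := slice cDR ht
    rw [← sub_eq_zero, ← intervalIntegral.integral_sub iD (iP t ht),
      intervalIntegral.integral_eq_sub_of_hasDerivAt
        (f := fun y => X t y ^ 2 * ρ t (X t y) * (W t y - u t (X t y))) _ (iD.sub (iP t ht))]
    · simp [hX, hW, hV, hL]
    · intro y hy
      rw [uIcc_of_le zero_le_one] at hy
      have hXy : HasDerivAt (fun y => X t y) (L t) y :=
        (((hasDerivAt_id y).const_mul (L t)).const_add (bm t)).congr_deriv (mul_one _)
      have hWy : HasDerivAt (fun y => W t y) (V t) y :=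
        (((hasDerivAt_id y).const_mul (V t)).const_add (u t (bm t))).congr_deriv (mul_one _)
      have hmem := hXmem t ht y hy
      have hρy := (hρx t ht _ hmem).comp y hXy
      have huy := (hux t ht _ hmem).comp y hXy
      refine (((hXy.pow 2).mul hρy).mul (hWy.sub huy)).congr_deriv ?_
      simp only [hD, Pi.pow_apply, Pi.mul_apply, Pi.sub_apply, Function.comp_apply]
      push_cast
      linear_combination -(L t * X t y ^ 2) * hmass t ht _ hmem
  have hle : ∀ t ∈ Ioo 0 T, ∫ y in (0:ℝ)..1, D t y ≤ (∫ y in (0:ℝ)..1, G t y) + E := by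
    intro t ht
    have ht' := Ioo_subset_Icc_self ht
    have iG := slice cGR ht'
    have iK : IntervalIntegrable (fun y => L t * (ρ t (X t y) * u t (X t y) ^ 2)) volume 0 1 :=
      slice (f := fun t y => L t * (ρ t (X t y) * u t (X t y) ^ 2))
        (cLR.mul (cρR.mul (cuR.pow 2))) ht'
    have hK := hkin t ht'
    rw [subst (fun s x => ρ s x * u s x ^ 2)] at hK
    calc ∫ y in (0:ℝ)..1, D t y
        = ∫ y in (0:ℝ)..1, L t * (2 * X t y * ρ t (X t y) * u t (X t y)) := hflux t ht'
      _ ≤ ∫ y in (0:ℝ)..1, (G t y + L t * (ρ t (X t y) * u t (X t y) ^ 2)) := by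
          refine intervalIntegral.integral_mono_on zero_le_one (iP t ht') (iG.add iK) fun y hy => ?_
          have hLρ : 0 ≤ L t * ρ t (X t y) :=
            mul_nonneg (sub_nonneg.2 (hb t ht').le) (hρpos t ht' _ (hXmem t ht' y hy)).le
          simp only [hG]
          nlinarith [mul_nonneg hLρ (sq_nonneg (X t y - u t (X t y)))]
      _ = (∫ y in (0:ℝ)..1, G t y) + ∫ y in (0:ℝ)..1, L t * (ρ t (X t y) * u t (X t y) ^ 2) :=
          intervalIntegral.integral_add iG iK
      _ ≤ _ := by gcongr
  intro t ht
  have h := add_le_exp_mul_of_deriv_le (continuousOn_intervalIntegral_of_rectangle cGR)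
    (fun t ht => hasDerivAt_intervalIntegral_of_rectangle cGR cDR hGD ht) hle ht
  rw [subst (fun s x => x ^ 2 * ρ s x), subst (fun s x => x ^ 2 * ρ s x)]
  exact (le_add_of_nonneg_right hE).trans h
end

section
/- Interaction-energy derivative identity (identity (result) in the proof of Lemma 3.1): Let b⁻, b⁺ : [0,T] → ℝ be C¹ with b⁻(t) < b⁺(t), and let ρ > 0 and u be C¹ functions on Ω_T = {(t,x) : 0 ≤ t ≤ T, b⁻(t) ≤ x ≤ b⁺(t)} satisfying the continuity equation ρ_t + (ρu)_x = 0 on Ω_T and the boundary ODEs (b±)'(t) = u(t, b±(t)). Let W(x) = −|x| + x²/2 and set (W∗ρ)(t,x) = ∫_{b⁻(t)}^{b⁺(t)} W(x−y) ρ(t,y) dy. Then for every t ∈ [0,T], d/dt [ ½ ∫_{b⁻(t)}^{b⁺(t)} ρ(t,x) (W∗ρ)(t,x) dx ] = ∫_{b⁻(t)}^{b⁺(t)} ρ(t,x) u(t,x) ( ∫_{b⁻(t)}^{b⁺(t)} (1 − 2H(x−y) + x − y) ρ(t,y) dy ) dx, where H denotes the Heaviside function (H(z) = 1 for z > 0 and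 H(z) = 0 for z ≤ 0). -/
open Real MeasureTheory Set

/-- Differentiation under the integral sign over a fixed interval, up to the endpoints of the
parameter interval, for jointly continuous data. -/
theorem hasDerivWithinAt_integral_of_continuous {T a b : ℝ} (hab : a ≤ b) {F F' : ℝ → ℝ → ℝ}
    (hF : Continuous fun p : ℝ × ℝ => F p.1 p.2) (hF' : Continuous fun p : ℝ × ℝ => F' p.1 p.2)
    (h : ∀ s ∈ Ioo 0 T, ∀ ξ ∈ Ioo a b, HasDerivAt (fun s => F s ξ) (F' s ξ) s)
    {t : ℝ} (ht : t ∈ Icc 0 T) :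
    HasDerivWithinAt (fun s => ∫ ξ in a..b, F s ξ) (∫ ξ in a..b, F' t ξ) (Icc 0 T) t := by
  have hcont : Continuous fun s => ∫ ξ in a..b, F' s ξ := by fun_prop
  have hmain : ∀ s ∈ Icc 0 T, ∫ ξ in a..b, F s ξ =
      (∫ ξ in a..b, F 0 ξ) + ∫ σ in 0..s, ∫ ξ in a..b, F' σ ξ := by
    intro s hs
    have hint : IntegrableOn (Function.uncurry F') (uIoc 0 s ×ˢ uIoc a b) :=
      (hF'.continuousOn.integrableOn_compact
        (isCompact_uIcc.prod isCompact_uIcc)).mono_set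
        (prod_mono uIoc_subset_uIcc uIoc_subset_uIcc)
    rw [intervalIntegral_intervalIntegral_swap hint, ← intervalIntegral.integral_add]
    · refine intervalIntegral.integral_congr_Ioo_of_le hab fun ξ hξ => ?_
      have := intervalIntegral.integral_eq_sub_of_hasDerivAt_of_le hs.1
        (f := fun s => F s ξ) (f' := fun s => F' s ξ) (by fun_prop)
        (fun σ hσ => h σ ⟨hσ.1, hσ.2.trans_le hs.2⟩ ξ hξ)
        (Continuous.intervalIntegrable (by fun_prop) _ _)
      simp only [this]
      ring
    · exact Continuous.intervalIntegrable (by fun_prop) _ _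
    · exact Continuous.intervalIntegrable (by fun_prop) _ _
  refine HasDerivWithinAt.congr ?_ hmain (hmain t ht)
  exact ((hcont.integral_hasStrictDerivAt 0 t).hasDerivAt.const_add _).hasDerivWithinAt

/-- Time derivative of the quadratic interaction energy on the unit interval with a symmetric
time-dependent kernel `w`. -/
theorem hasDerivWithinAt_quadratic_energy {T : ℝ} {r g : ℝ → ℝ → ℝ} {w w' : ℝ → ℝ → ℝ → ℝ}
    (hr : Continuous fun p : ℝ × ℝ => r p.1 p.2) (hg : Continuous fun p : ℝ × ℝ => g p.1 p.2)
    (hw : Continuous fun p : ℝ × ℝ × ℝ => w p.1 p.2.1 p.2.2)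
    (hw' : Continuous fun p : ℝ × ℝ × ℝ => w' p.1 p.2.1 p.2.2)
    (hwsymm : ∀ s ξ η, w s ξ η = w s η ξ)
    (hrg : ∀ s ∈ Ioo 0 T, ∀ ξ ∈ Ioo (0 : ℝ) 1, HasDerivAt (fun s => r s ξ) (g s ξ) s)
    (hww' : ∀ s ∈ Ioo 0 T, ∀ ξ η, HasDerivAt (fun s => w s ξ η) (w' s ξ η) s)
    {t : ℝ} (ht : t ∈ Icc 0 T) :
    HasDerivWithinAt
      (fun s => 1 / 2 * ∫ ξ in (0 : ℝ)..1, r s ξ * ∫ η in (0 : ℝ)..1, w s ξ η * r s η)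
      ((∫ ξ in (0 : ℝ)..1, g t ξ * ∫ η in (0 : ℝ)..1, w t ξ η * r t η) +
        1 / 2 * ∫ ξ in (0 : ℝ)..1, r t ξ * ∫ η in (0 : ℝ)..1, w' t ξ η * r t η)
      (Icc 0 T) t := by
  have hinner : ∀ s ∈ Ioo 0 T, ∀ ξ, HasDerivAt (fun s => ∫ η in (0 : ℝ)..1, w s ξ η * r s η)
      (∫ η in (0 : ℝ)..1, (w' s ξ η * r s η + w s ξ η * g s η)) s := by
    intro s hs ξ
    exact (hasDerivWithinAt_integral_of_continuous zero_le_one (F := fun s η => w s ξ η * r s η)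
      (F' := fun s η => w' s ξ η * r s η + w s ξ η * g s η) (by fun_prop) (by fun_prop)
      (fun s hs η hη => (hww' s hs ξ η).mul (hrg s hs η hη)) (Ioo_subset_Icc_self hs)).hasDerivAt
      (Icc_mem_nhds hs.1 hs.2)
  have houter := (hasDerivWithinAt_integral_of_continuous zero_le_one
    (F := fun s ξ => r s ξ * ∫ η in (0 : ℝ)..1, w s ξ η * r s η)
    (F' := fun s ξ => g s ξ * (∫ η in (0 : ℝ)..1, w s ξ η * r s η) +
      r s ξ * ∫ η in (0 : ℝ)..1, (w' s ξ η * r s η + w s ξ η * g s η))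
    (by fun_prop) (by fun_prop)
    (fun s hs ξ hξ => (hrg s hs ξ hξ).mul (hinner s hs ξ)) ht).const_mul (1 / 2)
  refine houter.congr_deriv ?_
  have hsplit : ∀ ξ, ∫ η in (0 : ℝ)..1, (w' t ξ η * r t η + w t ξ η * g t η) =
      (∫ η in (0 : ℝ)..1, w' t ξ η * r t η) + ∫ η in (0 : ℝ)..1, w t ξ η * g t η := fun ξ =>
    intervalIntegral.integral_add (Continuous.intervalIntegrable (by fun_prop) _ _)
      (Continuous.intervalIntegrable (by fun_prop) _ _)
  have hswap : ∫ ξ in (0 : ℝ)..1, r t ξ * ∫ η in (0 : ℝ)..1, w t ξ η * g t η =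
      ∫ ξ in (0 : ℝ)..1, g t ξ * ∫ η in (0 : ℝ)..1, w t ξ η * r t η := by
    simp_rw [← intervalIntegral.integral_const_mul]
    rw [intervalIntegral_intervalIntegral_swap]
    · refine intervalIntegral.integral_congr fun ξ _ =>
        intervalIntegral.integral_congr fun η _ => ?_
      simp only [hwsymm t ξ η]
      ring
    · refine (Continuous.continuousOn ?_).integrableOn_compact
        (isCompact_uIcc.prod isCompact_uIcc) |>.mono_set
        (prod_mono uIoc_subset_uIcc uIoc_subset_uIcc)
      unfold Function.uncurry
      fun_prop
  simp_rw [hsplit, mul_add]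
  rw [intervalIntegral.integral_add, intervalIntegral.integral_add, hswap]
  · ring
  all_goals exact Continuous.intervalIntegrable (by fun_prop) _ _

theorem integral_abs_sub_mul {r : ℝ → ℝ} (hr : Continuous r) {a b ξ : ℝ} (hξ : ξ ∈ Icc a b) :
    ∫ η in a..b, |ξ - η| * r η =
      2 * ξ * (∫ η in a..ξ, r η) - 2 * (∫ η in a..ξ, η * r η) +
        (∫ η in a..b, η * r η) - ξ * ∫ η in a..b, r η := by
  have hi : ∀ f : ℝ → ℝ, Continuous f → ∀ c d, IntervalIntegrable f volume c d :=
    fun f hf c d => hf.intervalIntegrable c d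
  rw [← intervalIntegral.integral_add_adjacent_intervals (hi _ (by fun_prop) a ξ)
      (hi _ (by fun_prop) ξ b),
    ← intervalIntegral.integral_add_adjacent_intervals (hi (fun η => η * r η) (by fun_prop) a ξ)
      (hi _ (by fun_prop) ξ b),
    ← intervalIntegral.integral_add_adjacent_intervals (hi r hr a ξ) (hi _ hr ξ b)]
  have h1 : ∫ η in a..ξ, |ξ - η| * r η = ξ * (∫ η in a..ξ, r η) - ∫ η in a..ξ, η * r η := by
    rw [← intervalIntegral.integral_const_mul, ← intervalIntegral.integral_sub
      (hi _ (by fun_prop) _ _) (hi _ (by fun_prop) _ _)]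
    refine intervalIntegral.integral_congr_Ioo_of_le hξ.1 fun η hη => ?_
    simp only [abs_of_pos (sub_pos.2 hη.2)]
    ring
  have h2 : ∫ η in ξ..b, |ξ - η| * r η = (∫ η in ξ..b, η * r η) - ξ * ∫ η in ξ..b, r η := by
    rw [← intervalIntegral.integral_const_mul, ← intervalIntegral.integral_sub
      (hi _ (by fun_prop) _ _) (hi _ (by fun_prop) _ _)]
    refine intervalIntegral.integral_congr_Ioo_of_le hξ.2 fun η hη => ?_
    simp only [abs_of_neg (sub_neg.2 hη.1)]
    ring
  rw [h1, h2]
  ring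

theorem integral_sub_sq_mul {r : ℝ → ℝ} (hr : Continuous r) (a b ξ : ℝ) :
    ∫ η in a..b, (ξ - η) ^ 2 * r η =
      ξ ^ 2 * (∫ η in a..b, r η) - 2 * ξ * (∫ η in a..b, η * r η) +
        ∫ η in a..b, η ^ 2 * r η := by
  rw [← intervalIntegral.integral_const_mul, ← intervalIntegral.integral_const_mul,
    ← intervalIntegral.integral_sub, ← intervalIntegral.integral_add]
  · exact intervalIntegral.integral_congr fun η _ => by ring
  all_goals exact Continuous.intervalIntegrable (by fun_prop) _ _

theorem integral_heaviside_kernel_mul {r : ℝ → ℝ} (hr : Continuous r) {a b ξ L : ℝ}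
    (hL : 0 < L) (hξ : ξ ∈ Icc a b) :
    ∫ η in a..b, (1 - 2 * (if 0 < L * (ξ - η) then (1 : ℝ) else 0) + L * (ξ - η)) * r η =
      (∫ η in a..b, r η) - 2 * (∫ η in a..ξ, r η) +
        L * (ξ * (∫ η in a..b, r η) - ∫ η in a..b, η * r η) := by
  have hi : ∀ f : ℝ → ℝ, Continuous f → ∀ c d, IntervalIntegrable f volume c d :=
    fun f hf c d => hf.intervalIntegrable c d
  have h1 : EqOn (fun η => (-1 + L * (ξ - η)) * r η)
      (fun η => (1 - 2 * (if 0 < L * (ξ - η) then (1 : ℝ) else 0) + L * (ξ - η)) * r η)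
      (Ioo a ξ) := fun η hη => by
    simp only [if_pos (mul_pos hL (sub_pos.2 hη.2))]
    ring
  have h2 : EqOn (fun η => (1 + L * (ξ - η)) * r η)
      (fun η => (1 - 2 * (if 0 < L * (ξ - η) then (1 : ℝ) else 0) + L * (ξ - η)) * r η)
      (Ioo ξ b) := fun η hη => by
    simp only [if_neg (mul_neg_of_pos_of_neg hL (sub_neg.2 hη.1)).not_gt]
    ring
  rw [← intervalIntegral.integral_add_adjacent_intervals
      ((hi _ (by fun_prop) a ξ).congr_uIoo (uIoo_of_le hξ.1 ▸ h1))
      ((hi _ (by fun_prop) ξ b).congr_uIoo (uIoo_of_le hξ.2 ▸ h2)),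
    ← intervalIntegral.integral_congr_Ioo_of_le hξ.1 h1,
    ← intervalIntegral.integral_congr_Ioo_of_le hξ.2 h2,
    ← intervalIntegral.integral_add_adjacent_intervals (hi (fun η => η * r η) (by fun_prop) a ξ)
      (hi _ (by fun_prop) ξ b),
    ← intervalIntegral.integral_add_adjacent_intervals (hi r hr a ξ) (hi _ hr ξ b)]
  have h : ∀ c d e : ℝ, ∫ η in d..e, (c + L * (ξ - η)) * r η =
      (c + L * ξ) * (∫ η in d..e, r η) - L * ∫ η in d..e, η * r η := by
    intro c d e
    rw [← intervalIntegral.integral_const_mul, ← intervalIntegral.integral_const_mul,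
      ← intervalIntegral.integral_sub (hi _ (by fun_prop) _ _) (hi _ (by fun_prop) _ _)]
    exact intervalIntegral.integral_congr fun η _ => by ring
  rw [h, h]
  ring

/-- Integration by parts for the interaction energy in rescaled coordinates: the flux `Q` relative
to the moving frame `b' + ξ L'` is traded for the force generated by `r`. -/
theorem integral_flux_interaction {r g Q u : ℝ → ℝ} {L L' b' : ℝ} (hL : 0 < L)
    (hr : Continuous r) (hg : Continuous g) (hQ : Continuous Q) (hu : Continuous u)
    (hQg : ∀ ξ ∈ Ioo (0 : ℝ) 1, HasDerivAt Q (-g ξ) ξ)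
    (hQr : ∀ ξ ∈ Ioo (0 : ℝ) 1, L * Q ξ = r ξ * (u ξ - (b' + ξ * L'))) (hQ0 : Q 0 = 0) (hQ1 : Q 1 = 0) :
    (∫ ξ in (0 : ℝ)..1, g ξ * ∫ η in (0 : ℝ)..1,
        (-(L * |ξ - η|) + (L * (ξ - η)) ^ 2 / 2) * r η) +
      1 / 2 * ∫ ξ in (0 : ℝ)..1, r ξ * ∫ η in (0 : ℝ)..1,
        (L' * (-|ξ - η| + L * (ξ - η) ^ 2)) * r η =
    ∫ ξ in (0 : ℝ)..1, r ξ * u ξ * ∫ η in (0 : ℝ)..1,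
      (1 - 2 * (if 0 < L * (ξ - η) then (1 : ℝ) else 0) + L * (ξ - η)) * r η := by
  have hi : ∀ f : ℝ → ℝ, Continuous f → ∀ c d, IntervalIntegrable f volume c d :=
    fun f hf c d => hf.intervalIntegrable c d
  set M0 : ℝ → ℝ := fun ξ => ∫ η in (0 : ℝ)..ξ, r η with hM0
  set M1 : ℝ → ℝ := fun ξ => ∫ η in (0 : ℝ)..ξ, η * r η with hM1
  set M2 : ℝ → ℝ := fun ξ => ∫ η in (0 : ℝ)..ξ, η ^ 2 * r η with hM2
  have d0 : ∀ ξ, HasDerivAt M0 (r ξ) ξ := fun ξ => (hr.integral_hasStrictDerivAt 0 ξ).hasDerivAt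
  have d1 : ∀ ξ, HasDerivAt M1 (ξ * r ξ) ξ := fun ξ =>
    (Continuous.integral_hasStrictDerivAt (f := fun η => η * r η) (by fun_prop) 0 ξ).hasDerivAt
  have d2 : ∀ ξ, HasDerivAt M2 (ξ ^ 2 * r ξ) ξ := fun ξ =>
    (Continuous.integral_hasStrictDerivAt (f := fun η => η ^ 2 * r η) (by fun_prop) 0 ξ).hasDerivAt
  have c0 : Continuous M0 := continuous_iff_continuousAt.2 fun ξ => (d0 ξ).continuousAt
  have c1 : Continuous M1 := continuous_iff_continuousAt.2 fun ξ => (d1 ξ).continuousAt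
  have c2 : Continuous M2 := continuous_iff_continuousAt.2 fun ξ => (d2 ξ).continuousAt
  set A : ℝ → ℝ := fun ξ => 2 * ξ * M0 ξ - 2 * M1 ξ + M1 1 - ξ * M0 1 with hA
  set B : ℝ → ℝ := fun ξ => ξ ^ 2 * M0 1 - 2 * ξ * M1 1 + M2 1 with hB
  set K : ℝ → ℝ := fun ξ => M0 1 - 2 * M0 ξ + L * (ξ * M0 1 - M1 1) with hK
  have e1 : ∀ ξ ∈ Ioo (0 : ℝ) 1, ∀ c d : ℝ,
      ∫ η in (0 : ℝ)..1, (c * |ξ - η| + d * (ξ - η) ^ 2) * r η = c * A ξ + d * B ξ := by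
    intro ξ hξ c d
    simp only [hA, hB, hM0, hM1, hM2]
    rw [← integral_abs_sub_mul hr (Ioo_subset_Icc_self hξ), ← integral_sub_sq_mul hr,
      ← intervalIntegral.integral_const_mul, ← intervalIntegral.integral_const_mul,
      ← intervalIntegral.integral_add (hi _ (by fun_prop) _ _) (hi _ (by fun_prop) _ _)]
    exact intervalIntegral.integral_congr fun η _ => by ring
  have hG : ∫ ξ in (0 : ℝ)..1, g ξ * ∫ η in (0 : ℝ)..1,
        (-(L * |ξ - η|) + (L * (ξ - η)) ^ 2 / 2) * r η =
      ∫ ξ in (0 : ℝ)..1, g ξ * (-L * A ξ + L ^ 2 / 2 * B ξ) :=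
    intervalIntegral.integral_congr_Ioo_of_le zero_le_one fun ξ hξ => by
      simp only [← e1 ξ hξ]
      congr 2
      funext η
      ring
  have hS : ∫ ξ in (0 : ℝ)..1, r ξ * ∫ η in (0 : ℝ)..1,
        (L' * (-|ξ - η| + L * (ξ - η) ^ 2)) * r η =
      ∫ ξ in (0 : ℝ)..1, r ξ * (-L' * A ξ + L' * L * B ξ) :=
    intervalIntegral.integral_congr_Ioo_of_le zero_le_one fun ξ hξ => by
      simp only [← e1 ξ hξ]
      congr 2
      funext η
      ring
  have hH : ∫ ξ in (0 : ℝ)..1, r ξ * u ξ * ∫ η in (0 : ℝ)..1,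
        (1 - 2 * (if 0 < L * (ξ - η) then (1 : ℝ) else 0) + L * (ξ - η)) * r η =
      ∫ ξ in (0 : ℝ)..1, r ξ * u ξ * K ξ :=
    intervalIntegral.integral_congr_Ioo_of_le zero_le_one fun ξ hξ => by
      simp only [integral_heaviside_kernel_mul hr hL (Ioo_subset_Icc_self hξ), hK, hM0, hM1]
  have cA : Continuous A := by fun_prop
  have cB : Continuous B := by fun_prop
  have cK : Continuous K := by fun_prop
  rw [hG, hS, hH, ← sub_eq_zero, ← intervalIntegral.integral_const_mul,
    ← intervalIntegral.integral_add (hi _ (by fun_prop) _ _) (hi _ (by fun_prop) _ _),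
    ← intervalIntegral.integral_sub (hi _ (by fun_prop) _ _) (hi _ (by fun_prop) _ _),
    intervalIntegral.integral_eq_sub_of_hasDerivAt_of_le zero_le_one
      (f := fun ξ => -(Q ξ * (-L * A ξ + L ^ 2 / 2 * B ξ)) -
        b' * (M0 1 * M0 ξ - M0 ξ ^ 2 + L * (M0 1 * M1 ξ - M1 1 * M0 ξ)) -
        L' * ((M0 1 * M1 ξ + M1 1 * M0 ξ) / 2 - M0 ξ * M1 ξ +
          L * (M0 1 * M2 ξ - M2 1 * M0 ξ) / 2))
      (by fun_prop) _ (hi _ (by fun_prop) _ _)]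
  · have z0 : M0 0 = 0 := by simp [hM0]
    have z1 : M1 0 = 0 := by simp [hM1]
    have z2 : M2 0 = 0 := by simp [hM2]
    simp only [hQ0, hQ1, z0, z1, z2]
    ring
  · intro ξ hξ
    have dA : HasDerivAt A (2 * M0 ξ - M0 1) ξ := by
      refine (((((hasDerivAt_id ξ).const_mul 2).mul (d0 ξ)).sub ((d1 ξ).const_mul 2)).add_const
        (M1 1)).sub ((hasDerivAt_id ξ).mul_const (M0 1)) |>.congr_deriv ?_
      simp only [id]
      ring
    have dB : HasDerivAt B (2 * ξ * M0 1 - 2 * M1 1) ξ := by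
      refine ((((hasDerivAt_id ξ).pow 2).mul_const (M0 1)).sub
        (((hasDerivAt_id ξ).const_mul 2).mul_const (M1 1))).add_const (M2 1) |>.congr_deriv ?_
      simp
    have dG := (hQg ξ hξ).mul ((dA.const_mul (-L)).add (dB.const_mul (L ^ 2 / 2)))
    have dV := ((((d0 ξ).const_mul (M0 1)).sub ((d0 ξ).pow 2)).add
      ((((d1 ξ).const_mul (M0 1)).sub ((d0 ξ).const_mul (M1 1))).const_mul L)).const_mul b'
    have dW := ((((((d1 ξ).const_mul (M0 1)).add ((d0 ξ).const_mul (M1 1))).div_const 2).sub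
      ((d0 ξ).mul (d1 ξ))).add (((((d2 ξ).const_mul (M0 1)).sub
        ((d0 ξ).const_mul (M2 1))).const_mul L).div_const 2)).const_mul L'
    refine ((dG.neg.sub dV).sub dW).congr_deriv ?_
    simp only [hA, hB, hK, Pi.add_apply]
    linear_combination (-(M0 1 - 2 * M0 ξ + L * (ξ * M0 1 - M1 1))) * hQr ξ hξ

/-- Derivative along a curve of a function of two real variables with continuous partial
derivatives. -/
theorem hasDerivAt_along_curve {f f₁ f₂ : ℝ → ℝ → ℝ} {γ : ℝ → ℝ} {t γ' : ℝ}
    (h₁ : ∀ᶠ q : ℝ × ℝ in nhds (t, γ t), HasDerivAt (fun s => f s q.2) (f₁ q.1 q.2) q.1)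
    (h₂ : ∀ᶠ q : ℝ × ℝ in nhds (t, γ t), HasDerivAt (fun y => f q.1 y) (f₂ q.1 q.2) q.2)
    (c₁ : ContinuousAt (fun q : ℝ × ℝ => f₁ q.1 q.2) (t, γ t))
    (c₂ : ContinuousAt (fun q : ℝ × ℝ => f₂ q.1 q.2) (t, γ t)) (hγ : HasDerivAt γ γ' t) :
    HasDerivAt (fun s => f s (γ s)) (f₁ t (γ t) + f₂ t (γ t) * γ') t := by
  have h := hasStrictFDerivAt_uncurry_coprod (𝕜 := ℝ) (u := (t, γ t)) (f := f)
    (f₁ := fun s x => ContinuousLinearMap.toSpanSingleton ℝ (f₁ s x))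
    (f₂ := fun s x => ContinuousLinearMap.toSpanSingleton ℝ (f₂ s x))
    (h₁.mono fun q hq => hq.hasFDerivAt) (h₂.mono fun q hq => hq.hasFDerivAt)
    ((ContinuousLinearMap.toSpanSingletonCLE (𝕜 := ℝ) (E := ℝ)).continuous.continuousAt.comp c₁)
    ((ContinuousLinearMap.toSpanSingletonCLE (𝕜 := ℝ) (E := ℝ)).continuous.continuousAt.comp c₂)
  refine (h.hasFDerivAt.comp_hasDerivAt t ((hasDerivAt_id t).prodMk hγ)).congr_deriv ?_
  simp [Function.HasUncurry.uncurry, mul_comm]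

/-- Interaction-energy derivative identity (identity (result) in the proof of Lemma 3.1):
with W(x) = -|x| + x²/2 and H the Heaviside function,
d/dt [½ ∫ ρ (W∗ρ) dx] = ∫ ρ u (∫ (1 - 2H(x-y) + x - y) ρ(t,y) dy) dx
on the moving domain. -/
theorem interaction_energy_derivative
    (T : ℝ) (hT : 0 < T)
    (bm bp : ℝ → ℝ) (ρ u ρt ρx ut ux : ℝ → ℝ → ℝ)
    (hb : ∀ t ∈ Set.Icc (0:ℝ) T, bm t < bp t)
    (hρpos : ∀ t ∈ Set.Icc (0:ℝ) T, ∀ x ∈ Set.Icc (bm t) (bp t), 0 < ρ t x)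
    (hρt : ∀ t ∈ Set.Icc (0:ℝ) T, ∀ x ∈ Set.Icc (bm t) (bp t),
      HasDerivAt (fun s => ρ s x) (ρt t x) t)
    (hρx : ∀ t ∈ Set.Icc (0:ℝ) T, ∀ x ∈ Set.Icc (bm t) (bp t),
      HasDerivAt (fun y => ρ t y) (ρx t x) x)
    (hut : ∀ t ∈ Set.Icc (0:ℝ) T, ∀ x ∈ Set.Icc (bm t) (bp t),
      HasDerivAt (fun s => u s x) (ut t x) t)
    (hux : ∀ t ∈ Set.Icc (0:ℝ) T, ∀ x ∈ Set.Icc (bm t) (bp t),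
      HasDerivAt (fun y => u t y) (ux t x) x)
    (hcont : ContinuousOn
      (fun q : ℝ × ℝ => (ρ q.1 q.2, u q.1 q.2, ρt q.1 q.2, ρx q.1 q.2, ut q.1 q.2, ux q.1 q.2))
      {q : ℝ × ℝ | q.1 ∈ Set.Icc (0:ℝ) T ∧ q.2 ∈ Set.Icc (bm q.1) (bp q.1)})
    (hmass : ∀ t ∈ Set.Icc (0:ℝ) T, ∀ x ∈ Set.Icc (bm t) (bp t),
      ρt t x + (ρx t x * u t x + ρ t x * ux t x) = 0)
    (hbp : ∀ t ∈ Set.Icc (0:ℝ) T, HasDerivAt bp (u t (bp t)) t)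
    (hbm : ∀ t ∈ Set.Icc (0:ℝ) T, HasDerivAt bm (u t (bm t)) t) :
    ∀ t ∈ Set.Icc (0:ℝ) T,
      HasDerivWithinAt
        (fun s => 1/2 * ∫ x in bm s..bp s,
          ρ s x * ∫ y in bm s..bp s, (-|x - y| + (x - y)^2 / 2) * ρ s y)
        (∫ x in bm t..bp t,
          ρ t x * u t x *
            ∫ y in bm t..bp t,
              ((1:ℝ) - 2 * (if 0 < x - y then (1:ℝ) else 0) + (x - y)) * ρ t y)
        (Set.Icc (0:ℝ) T) t := by
  set c : ℝ → ℝ := fun s => max 0 (min T s) with hc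
  set e : ℝ → ℝ := fun ξ => max 0 (min 1 ξ) with he
  have hcc : Continuous c := by fun_prop
  have hec : Continuous e := by fun_prop
  have hcm : ∀ s, c s ∈ Icc 0 T := fun s => ⟨le_max_left _ _, max_le hT.le (min_le_left _ _)⟩
  have hem : ∀ ξ, e ξ ∈ Icc (0 : ℝ) 1 := fun ξ =>
    ⟨le_max_left _ _, max_le zero_le_one (min_le_left _ _)⟩
  have hcs : ∀ s ∈ Icc 0 T, c s = s := fun s hs => by simp [hc, hs.1, hs.2]
  have hes : ∀ ξ ∈ Icc (0 : ℝ) 1, e ξ = ξ := fun ξ hξ => by simp [he, hξ.1, hξ.2]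
  set D : Set (ℝ × ℝ) := {q : ℝ × ℝ | q.1 ∈ Icc (0:ℝ) T ∧ q.2 ∈ Icc (bm q.1) (bp q.1)} with hD
  have hbmc : Continuous fun s => bm (c s) :=
    (ContinuousOn.comp_continuous (s := Icc 0 T)
      (fun s hs => (hbm s hs).continuousAt.continuousWithinAt) hcc hcm)
  have hbpc : Continuous fun s => bp (c s) :=
    (ContinuousOn.comp_continuous (s := Icc 0 T)
      (fun s hs => (hbp s hs).continuousAt.continuousWithinAt) hcc hcm)
  set L : ℝ → ℝ := fun s => bp (c s) - bm (c s) with hL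
  have hLc : Continuous L :=
    hbpc.sub hbmc
  have hLpos : ∀ s, 0 < L s := fun s => sub_pos.2 (hb _ (hcm s))
  set X : ℝ → ℝ → ℝ := fun s ξ => L s * e ξ + bm (c s) with hX
  have hXc : Continuous fun p : ℝ × ℝ => X p.1 p.2 :=
    ((hLc.comp continuous_fst).mul (hec.comp continuous_snd)).add
      (hbmc.comp continuous_fst)
  have hXm : ∀ s ξ, X s ξ ∈ Icc (bm (c s)) (bp (c s)) := fun s ξ => by
    have h1 := mul_nonneg (hLpos s).le (hem ξ).1
    have h2 := mul_le_mul_of_nonneg_left (hem ξ).2 (hLpos s).le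
    constructor <;> simp only [hX, hL] at * <;> linarith
  have pull : ∀ f : ℝ → ℝ → ℝ, ContinuousOn (fun q : ℝ × ℝ => f q.1 q.2) D →
      Continuous fun p : ℝ × ℝ => f (c p.1) (X p.1 p.2) := fun f hf =>
    hf.comp_continuous (f := fun p : ℝ × ℝ => (c p.1, X p.1 p.2)) (by fun_prop)
      fun p => ⟨hcm p.1, hXm p.1 p.2⟩
  have hρD : ContinuousOn (fun q : ℝ × ℝ => ρ q.1 q.2) D := hcont.fst
  have huD : ContinuousOn (fun q : ℝ × ℝ => u q.1 q.2) D := hcont.snd.fst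
  have hρtD : ContinuousOn (fun q : ℝ × ℝ => ρt q.1 q.2) D := hcont.snd.snd.fst
  have hρxD : ContinuousOn (fun q : ℝ × ℝ => ρx q.1 q.2) D := hcont.snd.snd.snd.fst
  have Rc := pull ρ hρD
  have Uc := pull u huD
  have Rtc := pull ρt hρtD
  have Rxc := pull ρx hρxD
  have X0 : ∀ s, X s 0 = bm (c s) := fun s => by simp [hX, he]
  have X1 : ∀ s, X s 1 = bp (c s) := fun s => by simp [hX, he, hL]
  set um : ℝ → ℝ := fun s => u (c s) (bm (c s)) with hum
  set up : ℝ → ℝ := fun s => u (c s) (bp (c s)) with hup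
  have umc : Continuous um := by
    have : Continuous fun s => u (c s) (X s 0) := Uc.comp (f := fun s => (s, (0 : ℝ))) (by fun_prop)
    simpa only [X0] using this
  have upc : Continuous up := by
    have : Continuous fun s => u (c s) (X s 1) := Uc.comp (f := fun s => (s, (1 : ℝ))) (by fun_prop)
    simpa only [X1] using this
  have hceq : ∀ s ∈ Ioo 0 T, c =ᶠ[nhds s] id := fun s hs => by
    filter_upwards [Icc_mem_nhds hs.1 hs.2] with σ hσ using hcs σ hσ
  have hbmd : ∀ s ∈ Ioo 0 T, HasDerivAt (fun s => bm (c s)) (um s) s := fun s hs => by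
    have h := hbm s (Ioo_subset_Icc_self hs)
    simp only [hum, hcs s (Ioo_subset_Icc_self hs)]
    exact h.congr_of_eventuallyEq ((hceq s hs).fun_comp bm)
  have hbpd : ∀ s ∈ Ioo 0 T, HasDerivAt (fun s => bp (c s)) (up s) s := fun s hs => by
    have h := hbp s (Ioo_subset_Icc_self hs)
    simp only [hup, hcs s (Ioo_subset_Icc_self hs)]
    exact h.congr_of_eventuallyEq ((hceq s hs).fun_comp bp)
  have hLd : ∀ s ∈ Ioo 0 T, HasDerivAt L (up s - um s) s := fun s hs =>
    (hbpd s hs).sub (hbmd s hs)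
  set r : ℝ → ℝ → ℝ := fun s ξ => L s * ρ (c s) (X s ξ) with hr
  set g : ℝ → ℝ → ℝ := fun s ξ => (up s - um s) * ρ (c s) (X s ξ) +
    L s * (ρt (c s) (X s ξ) + ρx (c s) (X s ξ) * ((up s - um s) * e ξ + um s)) with hg
  have hrc : Continuous fun p : ℝ × ℝ => r p.1 p.2 :=
    (hLc.comp continuous_fst).mul Rc
  have hgc : Continuous fun p : ℝ × ℝ => g p.1 p.2 :=
    (((upc.sub umc).comp continuous_fst).mul Rc).add ((hLc.comp continuous_fst).mul
      (Rtc.add (Rxc.mul ((((upc.sub umc).comp continuous_fst).mul (hec.comp continuous_snd)).add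
        (umc.comp continuous_fst)))))
  have hrg : ∀ s ∈ Ioo 0 T, ∀ ξ ∈ Ioo (0 : ℝ) 1, HasDerivAt (fun s => r s ξ) (g s ξ) s := by
    intro s hs ξ hξ
    have hs' := hcs s (Ioo_subset_Icc_self hs)
    have hξ' := hes ξ (Ioo_subset_Icc_self hξ)
    have hXd : HasDerivAt (fun s => X s ξ) ((up s - um s) * e ξ + um s) s :=
      ((hLd s hs).mul_const (e ξ)).add (hbmd s hs)
    have hnear : D ∈ nhds (s, X s ξ) := by
      have h1 : ContinuousAt (fun q : ℝ × ℝ => bm q.1) (s, X s ξ) :=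
        (hbm s (Ioo_subset_Icc_self hs)).continuousAt.comp continuousAt_fst
      have h2 : ContinuousAt (fun q : ℝ × ℝ => bp q.1) (s, X s ξ) :=
        (hbp s (Ioo_subset_Icc_self hs)).continuousAt.comp continuousAt_fst
      have l1 : bm s < X s ξ := by
        have := mul_pos (hLpos s) hξ.1
        simp only [hX, hξ', hs']
        linarith
      have l2 : X s ξ < bp s := by
        have := mul_lt_mul_of_pos_left hξ.2 (hLpos s)
        simp only [hX, hξ', hL, hs'] at this ⊢
        linarith
      filter_upwards [continuousAt_fst.preimage_mem_nhds (Icc_mem_nhds hs.1 hs.2),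
        h1.eventually_lt continuousAt_snd l1, continuousAt_snd.eventually_lt h2 l2]
        with q q1 q2 q3 using ⟨q1, q2.le, q3.le⟩
    have hR : HasDerivAt (fun σ => ρ σ (X σ ξ))
        (ρt s (X s ξ) + ρx s (X s ξ) * ((up s - um s) * e ξ + um s)) s :=
      hasDerivAt_along_curve
        (Filter.mem_of_superset hnear fun q hq => hρt q.1 hq.1 q.2 hq.2)
        (Filter.mem_of_superset hnear fun q hq => hρx q.1 hq.1 q.2 hq.2)
        (hρtD.continuousAt hnear) (hρxD.continuousAt hnear) hXd
    have hR' : HasDerivAt (fun σ => ρ (c σ) (X σ ξ))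
        (ρt (c s) (X s ξ) + ρx (c s) (X s ξ) * ((up s - um s) * e ξ + um s)) s := by
      rw [hs']
      refine hR.congr_of_eventuallyEq ?_
      filter_upwards [hceq s hs] with σ hσ
      rw [hσ, id]
    exact (hLd s hs).mul hR'
  intro t ht
  have hct := hcs t ht
  have hE := hasDerivWithinAt_quadratic_energy hrc hgc
    (w := fun s ξ η => -(L s * |ξ - η|) + (L s * (ξ - η)) ^ 2 / 2)
    (w' := fun s ξ η => (up s - um s) * (-|ξ - η| + L s * (ξ - η) ^ 2))
    (by fun_prop) (by fun_prop)
    (fun s ξ η => by simp only [abs_sub_comm ξ η]; ring) hrg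
    (fun s hs ξ η => by
      refine (((hLd s hs).mul_const |ξ - η|).neg.add
        ((((hLd s hs).mul_const (ξ - η)).pow 2).div_const 2)).congr_deriv ?_
      simp only [Nat.cast_ofNat, Nat.add_one_sub_one, pow_one]
      ring) ht
  have hchange : ∀ s ∈ Icc 0 T, ∀ f : ℝ → ℝ,
      ∫ x in bm s..bp s, f x = ∫ ξ in (0 : ℝ)..1, L s * f (X s ξ) := by
    intro s hs f
    have h := intervalIntegral.mul_integral_comp_mul_add (f := f) (a := 0) (b := 1) (L s) (bm s)
    have h' : L s * 1 + bm s = bp s := by simp [hL, hcs s hs]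
    rw [mul_zero, zero_add, h'] at h
    rw [← h, ← intervalIntegral.integral_const_mul]
    refine intervalIntegral.integral_congr_Ioo_of_le zero_le_one fun ξ hξ => ?_
    simp only [hX, hcs s hs, hes ξ (Ioo_subset_Icc_self hξ)]
  have hXsub : ∀ s, ∀ ξ ∈ Ioo (0 : ℝ) 1, ∀ η ∈ Ioo (0 : ℝ) 1,
      X s ξ - X s η = L s * (ξ - η) := by
    intro s ξ hξ η hη
    simp only [hX, hes ξ (Ioo_subset_Icc_self hξ), hes η (Ioo_subset_Icc_self hη)]
    ring
  have henergy : ∀ s ∈ Icc 0 T,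
      (1 / 2 * ∫ x in bm s..bp s,
        ρ s x * ∫ y in bm s..bp s, (-|x - y| + (x - y)^2 / 2) * ρ s y) =
      1 / 2 * ∫ ξ in (0 : ℝ)..1, r s ξ * ∫ η in (0 : ℝ)..1,
        (-(L s * |ξ - η|) + (L s * (ξ - η)) ^ 2 / 2) * r s η := by
    intro s hs
    rw [hchange s hs]
    congr 1
    refine intervalIntegral.integral_congr_Ioo_of_le zero_le_one fun ξ hξ => ?_
    simp only [hchange s hs, hr, hcs s hs, ← mul_assoc]
    congr 1
    refine intervalIntegral.integral_congr_Ioo_of_le zero_le_one fun η hη => ?_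
    simp only [hXsub s ξ hξ η hη, abs_mul, abs_of_pos (hLpos s)]
    ring
  refine (hE.congr henergy (henergy t ht)).congr_deriv ?_
  have hu0 : u (c t) (X t 0) = um t := by rw [X0]
  have hu1 : u (c t) (X t 1) = up t := by rw [X1]
  have hcurve : Continuous fun ξ : ℝ => (t, ξ) := by fun_prop
  rw [integral_flux_interaction (hLpos t) (r := r t) (g := g t)
    (Q := fun ξ => ρ (c t) (X t ξ) * (u (c t) (X t ξ) - (um t + e ξ * (up t - um t))))
    (u := fun ξ => u (c t) (X t ξ)) (b' := um t) (L' := up t - um t)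
    (hrc.comp hcurve) (hgc.comp hcurve)
    ((Rc.comp hcurve).mul ((Uc.comp hcurve).sub (by fun_prop))) (Uc.comp hcurve)]
  · rw [hchange t ht]
    refine intervalIntegral.integral_congr_Ioo_of_le zero_le_one fun ξ hξ => ?_
    simp only [hchange t ht, hr, hct, ← mul_assoc]
    congr 1
    refine intervalIntegral.integral_congr_Ioo_of_le zero_le_one fun η hη => ?_
    simp only [hXsub t ξ hξ η hη]
    ring
  · intro ξ hξ
    have hee : e =ᶠ[nhds ξ] id := by
      filter_upwards [Icc_mem_nhds hξ.1 hξ.2] with σ hσ using hes σ hσ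
    have hed : HasDerivAt e 1 ξ := (hasDerivAt_id ξ).congr_of_eventuallyEq hee
    have hXd : HasDerivAt (fun ξ => X t ξ) (L t * 1) ξ := (hed.const_mul (L t)).add_const _
    have hRd := (hρx (c t) (hcm t) _ (hXm t ξ)).comp ξ hXd
    have hUd := (hux (c t) (hcm t) _ (hXm t ξ)).comp ξ hXd
    refine (hRd.mul (hUd.sub ((hed.mul_const (up t - um t)).const_add (um t)))).congr_deriv ?_
    simp only [hg, Function.comp, Pi.sub_apply]
    linear_combination (L t) * hmass (c t) (hcm t) _ (hXm t ξ)
  · intro ξ hξ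
    simp only [hr, hes ξ (Ioo_subset_Icc_self hξ)]
    ring
  · simp only [hu0, hes 0 ⟨le_rfl, zero_le_one⟩]
    ring
  · simp only [hu1, hes 1 ⟨zero_le_one, le_rfl⟩]
    ring
end
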